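/- arXiv:2603.26289 — 2 statements merged into one kernel-verified Lean document; each statement's English description precedes it below -/
import Mathlib

section
/- Let k be a field and A a non-rigid 𝔸²-form over k with respect to some field extension L/k. If A embeds as a k-subalgebra of a polynomial ring k^{[n]} for some n ≥ 2, then A ≅ k^{[2]}. -/
/-- An exponential map (equivalently, a `𝔾ₐ`-action) on a `k`-algebra `A`:
a `k`-algebra homomorphism `φ : A → A[U]` such that evaluation at `U = 0`
is the identity and the coaction axiom `φ_V ∘ φ_U = φ_{U+V}` holds. -/
structure ExpMap (k A : Type*) [Field k] [CommRing A] [Algebra k A] where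
  toFun : A →ₐ[k] Polynomial A
  eval_zero : ∀ a : A, (toFun a).eval 0 = a
  coaction : ∀ a : A,
    (toFun a).map (toFun.toRingHom) =
      (toFun a).eval₂ (Polynomial.C.comp Polynomial.C)
        (Polynomial.X + Polynomial.C Polynomial.X)

variable {k A : Type*} [Field k] [CommRing A] [Algebra k A]

/-- The ring of invariants `A^φ = {a ∈ A : φ(a) = a}` of an exponential map. -/
def ExpMap.invariants (φ : ExpMap k A) : Subalgebra k A where
  carrier := {a : A | φ.toFun a = Polynomial.C a}
  mul_mem' := by
    intro a b ha hb
    simp only [Set.mem_setOf_eq, map_mul] at *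
    rw [ha, hb]
  add_mem' := by
    intro a b ha hb
    simp only [Set.mem_setOf_eq, map_add] at *
    rw [ha, hb]
  algebraMap_mem' := by
    intro r
    simp only [Set.mem_setOf_eq, AlgHom.commutes, Polynomial.algebraMap_apply]

/-- An exponential map is nontrivial if its ring of invariants is a proper subring. -/
def ExpMap.Nontrivial (φ : ExpMap k A) : Prop := ∃ a : A, φ.toFun a ≠ Polynomial.C a


open Polynomial TensorProduct

namespace ExpMap

theorem coeff_toFun_coeff (φ : ExpMap k A) (a : A) (i j : ℕ) :
    (φ.toFun ((φ.toFun a).coeff i)).coeff j =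
      (φ.toFun a).coeff (i + j) * ((i + j).choose i : A) := by
  have h := congrArg (fun p => (p.coeff i).coeff j) (φ.coaction a)
  simp only [coeff_map] at h
  refine h.trans ?_
  simp only [eval₂_eq_sum, Polynomial.sum_def, finsetSum_coeff, RingHom.coe_comp,
    Function.comp_apply, coeff_C_mul, coeff_X_add_C_pow]
  rw [Finset.sum_eq_single (i + j)]
  · simp only [add_tsub_cancel_left]
    rw [← Polynomial.C_eq_natCast, coeff_mul_C, coeff_X_pow_self, one_mul]
  · intro m _ hm
    rw [← Polynomial.C_eq_natCast, coeff_mul_C, coeff_X_pow]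
    split_ifs with hj
    · have : m < i := by omega
      rw [Nat.choose_eq_zero_of_lt this]
      simp
    · simp
  · intro hm
    rw [notMem_support_iff.1 hm]
    simp

theorem mem_invariants (φ : ExpMap k A) {a : A} : a ∈ φ.invariants ↔ φ.toFun a = C a := Iff.rfl

theorem mem_invariants_of_eq_C (φ : ExpMap k A) {a b : A} (h : φ.toFun a = C b) :
    a ∈ φ.invariants := by
  have h0 := φ.eval_zero a
  rw [h, eval_C] at h0
  rw [mem_invariants, h, h0]

theorem mem_invariants_of_natDegree_eq_zero (φ : ExpMap k A) {a : A}
    (h : (φ.toFun a).natDegree = 0) : a ∈ φ.invariants :=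
  φ.mem_invariants_of_eq_C (eq_C_of_natDegree_eq_zero h)

theorem natDegree_coeff_le (φ : ExpMap k A) (a : A) (i : ℕ) :
    (φ.toFun ((φ.toFun a).coeff i)).natDegree ≤ (φ.toFun a).natDegree - i := by
  rw [natDegree_le_iff_coeff_eq_zero]
  intro j hj
  rw [coeff_toFun_coeff, coeff_eq_zero_of_natDegree_lt (by omega), zero_mul]

theorem mem_invariants_of_mul_mem [IsDomain A] (φ : ExpMap k A) {a b : A} (hb : b ≠ 0)
    (h : b * a ∈ φ.invariants) (hbR : b ∈ φ.invariants) : a ∈ φ.invariants := by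
  rw [mem_invariants, map_mul, C_mul, hbR] at h
  exact mul_left_cancel₀ (C_ne_zero.2 hb) h

end ExpMap

/-- If `n`-th powers are additive in the sense that the intermediate binomial coefficients
vanish, then `(q * n + r).choose r = 1` for `r < n`. -/
theorem cast_choose_mul_add_eq_one {B : Type*} [CommRing B] {n : ℕ} (hn : 0 < n)
    (h : ∀ j, 0 < j → j < n → (n.choose j : B) = 0) (q : ℕ) {r : ℕ} (hr : r < n) :
    ((q * n + r).choose r : B) = 1 := by
  have h1 : (X + 1 : B[X]) ^ n = 1 + X ^ n := by
    ext j
    rw [coeff_X_add_one_pow, coeff_add, coeff_one, coeff_X_pow]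
    rcases Nat.eq_zero_or_pos j with rfl | hj
    · simp [hn.ne]
    · rcases lt_trichotomy j n with hjn | rfl | hjn
      · simp [h j hj hjn, hjn.ne, hj.ne']
      · simp [hn.ne']
      · simp [Nat.choose_eq_zero_of_lt hjn, hjn.ne', hj.ne']
  obtain ⟨w, hw⟩ : (X ^ n : B[X]) ∣ (1 + X ^ n) ^ q - 1 := by
    have := sub_dvd_pow_sub_pow (1 + X ^ n : B[X]) 1 q
    simpa using this
  rw [← coeff_X_add_one_pow, pow_add, mul_comm q n, pow_mul, h1, eq_add_of_sub_eq hw, add_mul,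
    coeff_add, mul_assoc, coeff_X_pow_mul', if_neg (by omega), one_mul, coeff_X_add_one_pow]
  simp

/-- A local slice of a nontrivial exponential map. -/
theorem ExpMap.exists_local_slice [IsDomain A] (φ : ExpMap k A) (hφ : φ.Nontrivial) :
    ∃ s : A, s ∉ φ.invariants ∧
      ∀ a : A, ∃ g ∈ φ.invariants, g ≠ 0 ∧
        ∃ P : (φ.invariants)[X], aeval s P = g * a := by
  classical
  have hex : ∃ n, ∃ s : A, s ∉ φ.invariants ∧ (φ.toFun s).natDegree = n := by
    obtain ⟨a, ha⟩ := hφ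
    exact ⟨_, a, ha, rfl⟩
  obtain ⟨s, hs, hsn⟩ := Nat.find_spec hex
  set n := Nat.find hex with hn
  have hlt : ∀ a : A, (φ.toFun a).natDegree < n → a ∈ φ.invariants := by
    intro a ha
    by_contra hcon
    exact Nat.find_min hex ha ⟨a, hcon, rfl⟩
  have hnpos : 0 < n := by
    rw [← hsn]
    exact Nat.pos_of_ne_zero fun h => hs (φ.mem_invariants_of_natDegree_eq_zero h)
  have hcoef : ∀ i, 0 < i → (φ.toFun s).coeff i ∈ φ.invariants := fun i hi =>
    hlt _ ((φ.natDegree_coeff_le s i).trans_lt (by omega))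
  set c := (φ.toFun s).coeff n with hc
  have hcR : c ∈ φ.invariants := hcoef n hnpos
  have hc0 : c ≠ 0 := by
    rw [hc, ← hsn, coeff_natDegree, leadingCoeff_ne_zero]
    intro h0
    rw [h0] at hsn
    simp at hsn
    omega
  have hchoose : ∀ j, 0 < j → j < n → (n.choose j : A) = 0 := by
    intro j hj hjn
    have h := φ.coeff_toFun_coeff s j (n - j)
    rw [(φ.mem_invariants).1 (hcoef j hj), coeff_C, if_neg (by omega),
      Nat.add_sub_cancel' hjn.le] at h
    exact (mul_eq_zero.1 h.symm).resolve_left hc0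
  refine ⟨s, hs, fun a => ?_⟩
  induction hm : (φ.toFun a).natDegree using Nat.strong_induction_on generalizing a with
  | _ m ih =>
  by_cases ham : a ∈ φ.invariants
  · exact ⟨1, one_mem _, one_ne_zero, C ⟨a, ham⟩, by
      rw [aeval_C, one_mul]
      rfl⟩
  have hmpos : 0 < m := by
    rw [← hm]
    exact Nat.pos_of_ne_zero fun h => ham (φ.mem_invariants_of_natDegree_eq_zero h)
  set b := (φ.toFun a).coeff m with hb
  have hb0 : b ≠ 0 := by
    rw [hb, ← hm, coeff_natDegree, leadingCoeff_ne_zero]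
    intro h0
    rw [h0] at hm
    simp at hm
    omega
  obtain ⟨q, r, hrn, hqr⟩ : ∃ q r, r < n ∧ m = q * n + r :=
    ⟨m / n, m % n, Nat.mod_lt _ hnpos, (Nat.div_add_mod' m n).symm⟩
  have hr0 : r = 0 := by
    by_contra hr
    have h1 : (φ.toFun a).coeff (q * n) ∈ φ.invariants :=
      hlt _ ((φ.natDegree_coeff_le a _).trans_lt (by omega))
    have h := φ.coeff_toFun_coeff a (q * n) r
    rw [(φ.mem_invariants).1 h1, coeff_C, if_neg hr, ← hqr, ← hb, hqr,
      ← Nat.choose_symm_of_eq_add (a := r) (b := q * n) (by omega),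
      cast_choose_mul_add_eq_one hnpos hchoose q hrn, mul_one] at h
    exact hb0 h.symm
  subst hr0
  have hbR : b ∈ φ.invariants :=
     φ.mem_invariants_of_natDegree_eq_zero
      (Nat.le_zero.1 ((φ.natDegree_coeff_le a m).trans (by omega)))
  have hdeg : (φ.toFun (c ^ q * a - b * s ^ q)).natDegree < m := by
    have e : φ.toFun (c ^ q * a - b * s ^ q) = C (c ^ q) * φ.toFun a - C b * φ.toFun s ^ q := by
      rw [map_sub, map_mul, map_mul, map_pow, map_pow, (φ.mem_invariants).1 hcR,
        (φ.mem_invariants).1 hbR, C_pow]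
    rw [e]
    have hd2 : (φ.toFun s ^ q).natDegree = m := by rw [natDegree_pow, hsn, hqr, add_zero]
    have hle : (C (c ^ q) * φ.toFun a - C b * φ.toFun s ^ q).natDegree ≤ m :=
      (natDegree_sub_le _ _).trans (max_le ((natDegree_C_mul_le _ _).trans hm.le)
        ((natDegree_C_mul_le _ _).trans hd2.le))
    refine lt_of_le_of_ne hle fun heq => ?_
    have hz : (C (c ^ q) * φ.toFun a - C b * φ.toFun s ^ q).coeff m = 0 := by
      have h3 : (φ.toFun s ^ q).coeff m = c ^ q := by
        rw [← hd2, coeff_natDegree, leadingCoeff_pow, leadingCoeff, hsn]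
      rw [coeff_sub, coeff_C_mul, coeff_C_mul, h3, ← hb]
      ring
    rw [← heq, coeff_natDegree, leadingCoeff_eq_zero] at hz
    rw [hz, natDegree_zero] at heq
    omega
  obtain ⟨g, hg, hg0, P, hP⟩ := ih _ hdeg _ rfl
  refine ⟨g * c ^ q, mul_mem hg (pow_mem hcR q), mul_ne_zero hg0 (pow_ne_zero _ hc0),
    P + C ⟨g * b, mul_mem hg hbR⟩ * X ^ q, ?_⟩
  have e : algebraMap φ.invariants A ⟨g * b, mul_mem hg hbR⟩ = g * b := rfl
  rw [map_add, hP, map_mul, map_pow, aeval_X, aeval_C, e]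
  ring

namespace Polynomial

theorem coeff_coeff_bivariateSwap {B : Type*} [CommRing B] (p : B[X][X]) (i j : ℕ) :
    ((Bivariate.swap p).coeff i).coeff j = (p.coeff j).coeff i := by
  induction p using Polynomial.induction_on' with
  | add p q hp hq => simp only [map_add, coeff_add, hp, hq]
  | monomial n f =>
    rw [Bivariate.swap_monomial, coeff_mul_C, coeff_map, coeff_C_mul, coeff_X_pow, coeff_monomial]
    by_cases h : j = n
    · simp [h]
    · simp [h, Ne.symm h]

end Polynomial

/-- A polynomial `p(Y) - p(X)` can only be divided by a monic polynomial in `Y` which has a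
coefficient equal to `p(X)` when the degrees in `Y` agree. -/
theorem natDegree_eq_of_coeff_eq_of_dvd {F : Type*} [Field F] {p : F[X]} (hp : 0 < p.natDegree)
    {M : F[X][X]} (hM : M.Monic) {i : ℕ} (hi : M.coeff i = p)
    (hdvd : M ∣ p.map C - C p) : M.natDegree = p.natDegree := by
  obtain ⟨Q, hQ⟩ := hdvd
  have hp0 : p ≠ 0 := by
    rintro rfl
    simp at hp
  have hF : Bivariate.swap M * Bivariate.swap Q = C p - p.map C := by
    rw [← map_mul, ← hQ, map_sub, Bivariate.swap_map_C, Bivariate.swap_C]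
  have hmapdeg : (p.map (C : F →+* F[X])).natDegree = p.natDegree :=
    natDegree_map_eq_of_injective C_injective p
  have hFdeg : (C p - p.map (C : F →+* F[X])).natDegree = p.natDegree := by
    rw [← neg_sub, natDegree_neg, natDegree_sub_C, hmapdeg]
  have hFlead : (C p - p.map (C : F →+* F[X])).leadingCoeff = C (-p.leadingCoeff) := by
    rw [leadingCoeff, hFdeg, coeff_sub, coeff_C, if_neg hp.ne', coeff_map, zero_sub, C_neg]
    rfl
  have hF0 : C p - p.map (C : F →+* F[X]) ≠ 0 := by
    intro h
    rw [h, natDegree_zero] at hFdeg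
    omega
  rw [← hF] at hF0 hFdeg hFlead
  have hM0 := left_ne_zero_of_mul hF0
  have hQ0 := right_ne_zero_of_mul hF0
  rw [natDegree_mul hM0 hQ0] at hFdeg
  have hle : p.natDegree ≤ (Bivariate.swap M).natDegree := by
    apply le_natDegree_of_ne_zero
    intro h
    have := coeff_coeff_bivariateSwap M p.natDegree i
    rw [h, hi, coeff_zero, coeff_natDegree, eq_comm, leadingCoeff_eq_zero] at this
    exact hp0 this
  have hQd : (Bivariate.swap Q).natDegree = 0 := by omega
  obtain ⟨w, hw⟩ : ∃ w, Bivariate.swap Q = C w := ⟨_, eq_C_of_natDegree_eq_zero hQd⟩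
  have hwu : IsUnit w := by
    rw [leadingCoeff_mul, hw, leadingCoeff_C] at hFlead
    refine isUnit_of_mul_isUnit_right (x := (Bivariate.swap M).leadingCoeff) ?_
    rw [hFlead, isUnit_C, isUnit_iff_ne_zero, neg_ne_zero, Ne, leadingCoeff_eq_zero]
    exact hp0
  obtain ⟨c, -, rfl⟩ := Polynomial.isUnit_iff.1 hwu
  have hQc : Q = C (C c) := by
    rw [← Bivariate.swap_swap_apply Q, hw, Bivariate.swap_C_C]
  have hQne : Q ≠ 0 := by
    rintro rfl
    simp at hQ0
  have h := congrArg natDegree hQ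
  rw [natDegree_sub_C, hmapdeg, hM.natDegree_mul' hQne, hQc, natDegree_C, add_zero] at h
  exact h.symm

/-- An integrally closed subalgebra of `F[X]` is either `F` or a polynomial ring. -/
theorem exists_bijective_aeval_of_isIntegrallyClosed {F R : Type*} [Field F] [CommRing R]
    [IsDomain R] [IsIntegrallyClosed R] [Algebra F R] [Algebra R F[X]] [IsScalarTower F R F[X]]
    [FaithfulSMul R F[X]] (r₀ : R) (hr₀ : 0 < (algebraMap R F[X] r₀).natDegree) :
    ∃ t : R, 0 < (algebraMap R F[X] t).natDegree ∧
      Function.Bijective (aeval t : F[X] →ₐ[F] R) := by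
  have hinj : Function.Injective (algebraMap R F[X]) := FaithfulSMul.algebraMap_injective R F[X]
  have haev : ∀ r : R,
      aeval (X : F[X]) ((algebraMap R F[X] r).map (algebraMap F R) - C r) = 0 := by
    intro r
    rw [map_sub, aeval_map_algebraMap, aeval_C, aeval_X_left_apply, sub_self]
  have hint : IsIntegral R (X : F[X]) := by
    set p := algebraMap R F[X] r₀ with hp
    have hlc : p.leadingCoeff ≠ 0 := by
      rw [Ne, leadingCoeff_eq_zero]
      intro h
      rw [h] at hr₀
      simp at hr₀
    refine ⟨C (algebraMap F R p.leadingCoeff⁻¹) * (p.map (algebraMap F R) - C r₀), ?_, ?_⟩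
    · have hd : (C (algebraMap F R p.leadingCoeff⁻¹) *
          (p.map (algebraMap F R) - C r₀)).natDegree ≤ p.natDegree :=
        (natDegree_C_mul_le _ _).trans (by rw [natDegree_sub_C]; exact natDegree_map_le)
      refine monic_of_natDegree_le_of_coeff_eq_one _ hd ?_
      rw [coeff_C_mul, coeff_sub, coeff_C, if_neg hr₀.ne', coeff_map, sub_zero, ← map_mul,
        coeff_natDegree, inv_mul_cancel₀ hlc, map_one]
    · have := haev r₀
      rw [← aeval_def, map_mul, this, mul_zero]
  set m := minpoly R (X : F[X]) with hm
  have hmm : m.Monic := minpoly.monic hint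
  have hdvd : ∀ r : R, m ∣ (algebraMap R F[X] r).map (algebraMap F R) - C r := fun r =>
    minpoly.isIntegrallyClosed_dvd hint (haev r)
  have hMm : (m.map (algebraMap R F[X])).Monic := hmm.map _
  obtain ⟨i, hi⟩ : ∃ i, 0 < (algebraMap R F[X] (m.coeff i)).natDegree := by
    by_contra! hcon
    have : m.map (algebraMap R F[X]) =
        ((m.map (algebraMap R F[X])).map (evalRingHom 0)).map C := by
      ext1 i
      simp only [coeff_map, coe_evalRingHom, ← coeff_zero_eq_eval_zero]
      exact eq_C_of_natDegree_eq_zero (Nat.le_zero.1 (hcon i))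
    have h0 : (m.map (algebraMap R F[X])).eval X = 0 := by
      rw [eval_map_algebraMap]
      exact minpoly.aeval _ _
    rw [this, eval_map, ← algebraMap_eq, ← aeval_def, aeval_X_left_apply] at h0
    rw [h0, Polynomial.map_zero] at this
    exact hMm.ne_zero this
  set t := m.coeff i with ht
  set τ := algebraMap R F[X] t with hτ
  have hdeg : m.natDegree = τ.natDegree := by
    rw [← hmm.natDegree_map (algebraMap R F[X])]
    refine natDegree_eq_of_coeff_eq_of_dvd hi hMm (coeff_map _ _) ?_
    have := Polynomial.map_dvd (algebraMap R F[X]) (hdvd t)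
    rwa [Polynomial.map_sub, Polynomial.map_map, map_C, ← IsScalarTower.algebraMap_eq,
      algebraMap_eq] at this
  have hτ0 : τ ≠ 0 := by
    intro h
    rw [h] at hi
    simp at hi
  have key : ∀ p : F[X], ∃ P : R[X], P.degree < m.degree ∧
      P.coeff 0 ∈ (aeval t : F[X] →ₐ[F] R).range ∧ m ∣ p.map (algebraMap F R) - P := by
    intro p
    induction hd : p.degree using WellFoundedLT.induction generalizing p with
    | _ d ih =>
    by_cases hp : p = 0
    · refine ⟨0, ?_, ?_, ?_⟩
      · rw [degree_zero, bot_lt_iff_ne_bot, Ne, degree_eq_bot]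
        exact hmm.ne_zero
      · simp
      · simp [hp]
    obtain ⟨P, hP1, hP2, w, hP3⟩ :=
      ih _ (hd ▸ degree_div_lt hp (natDegree_pos_iff_degree_pos.1 hi)) (p / τ) rfl
    have hlt : (p % τ).degree < m.degree := by
      rw [degree_eq_natDegree hmm.ne_zero, hdeg, ← degree_eq_natDegree hτ0]
      exact EuclideanDomain.mod_lt _ hτ0
    obtain ⟨v, hv⟩ := hdvd t
    refine ⟨(p % τ).map (algebraMap F R) + C t * P, ?_, ?_, ?_⟩
    · refine (degree_add_le _ _).trans_lt (max_lt (degree_map_le.trans_lt hlt) ?_)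
      refine lt_of_le_of_lt ?_ hP1
      exact (degree_mul_le _ _).trans (by
        calc (C t).degree + P.degree ≤ 0 + P.degree := by gcongr; exact degree_C_le
          _ = P.degree := zero_add _)
    · rw [coeff_add, coeff_C_mul, coeff_map]
      refine add_mem (Subalgebra.algebraMap_mem _ _) (mul_mem ⟨X, by simp⟩ hP2)
    · refine ⟨v * (p / τ).map (algebraMap F R) + C t * w, ?_⟩
      have h := congrArg (Polynomial.map (algebraMap F R)) (EuclideanDomain.div_add_mod p τ)
      rw [Polynomial.map_add, Polynomial.map_mul] at h
      linear_combination (p / τ).map (algebraMap F R) * hv + C t * hP3 - h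
  refine ⟨t, hi, ?_, ?_⟩
  · have htr : Transcendental F t := by
      rw [← transcendental_algebraMap_iff hinj, ← hτ, transcendental_iff]
      intro p hp
      rw [← comp_eq_aeval, comp_eq_zero_iff] at hp
      rcases hp with hp | ⟨-, hp⟩
      · exact hp
      · rw [hp, natDegree_C] at hi
        omega
    exact transcendental_iff_injective.1 htr
  · intro r
    obtain ⟨P, hP1, hP2, hP3⟩ := key (algebraMap R F[X] r)
    have h : P - C r = 0 := by
      refine eq_zero_of_dvd_of_degree_lt
        (p := m) ?_ ((degree_sub_le _ _).trans_lt (max_lt hP1 ?_))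
      · have := dvd_sub (hdvd r) hP3
        rwa [sub_sub_sub_cancel_left] at this
      · refine degree_C_le.trans_lt ?_
        rw [degree_eq_natDegree hmm.ne_zero, hdeg]
        exact_mod_cast hi
    rw [sub_eq_zero.1 h, coeff_C_zero] at hP2
    exact hP2

theorem sum_pow_mul_injOn {n N : ℕ} (hN : 1 < N) {v w : Fin n →₀ ℕ} (hv : ∀ i, v i < N)
    (hw : ∀ i, w i < N) (h : ∑ i : Fin n, N ^ i.1 * v i = ∑ i : Fin n, N ^ i.1 * w i) :
    v = w := by
  refine Finsupp.ext <| congrFun <| List.ofFn_inj.mp ?_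
  apply Nat.ofDigits_inj_of_len_eq hN (by simp) (by grind) (by grind)
  simpa only [Nat.ofDigits_eq_sum_mapIdx, List.mapIdx_eq_ofFn, List.get_ofFn, List.length_ofFn,
    Fin.val_cast, mul_comm, List.sum_ofFn] using! h

/-- Kronecker substitution: a nonconstant polynomial can be specialized to a nonconstant
polynomial in one variable. -/
theorem exists_algHom_polynomial_natDegree_pos {F : Type*} [Field F] {n : ℕ}
    (p : MvPolynomial (Fin n) F) (hp : ∀ c : F, p ≠ MvPolynomial.C c) :
    ∃ h : MvPolynomial (Fin n) F →ₐ[F] F[X], 0 < (h p).natDegree := by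
  classical
  set N := 2 + p.totalDegree with hN
  have hlt : ∀ v ∈ p.support, ∀ i, v i < N := fun v hv i =>
    lt_of_le_of_lt ((MvPolynomial.monomial_le_degreeOf i hv).trans
      (MvPolynomial.degreeOf_le_totalDegree p i)) (by omega)
  obtain ⟨v, hv, hv0⟩ : ∃ v ∈ p.support, v ≠ 0 := by
    by_contra! hcon
    refine hp (p.coeff 0) ?_
    ext m
    rw [MvPolynomial.coeff_C]
    split_ifs with hm
    · rw [hm]
    · exact MvPolynomial.notMem_support_iff.1 fun h => hm (hcon m h).symm
  refine ⟨MvPolynomial.aeval fun i => (X : F[X]) ^ N ^ i.1, ?_⟩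
  have hsum : MvPolynomial.aeval (fun i : Fin n => (X : F[X]) ^ N ^ i.1) p =
      ∑ w ∈ p.support, C (p.coeff w) * X ^ ∑ i : Fin n, N ^ i.1 * w i := by
    rw [MvPolynomial.aeval_def, MvPolynomial.eval₂_eq']
    refine Finset.sum_congr rfl fun w _ => ?_
    simp only [← pow_mul, Finset.prod_pow_eq_pow_sum, algebraMap_eq]
  have hpos : ∑ i : Fin n, N ^ i.1 * v i ≠ 0 := by
    intro h
    refine hv0 (sum_pow_mul_injOn (N := N) (by omega) (hlt v hv) (w := 0) ?_ ?_)
    · intro i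
      simp only [Finsupp.coe_zero, Pi.zero_apply]
      omega
    · simpa using h
  refine (Nat.pos_of_ne_zero hpos).trans_le (le_natDegree_of_ne_zero ?_)
  rw [hsum, finsetSum_coeff, Finset.sum_eq_single v]
  · rw [coeff_C_mul, coeff_X_pow_self, mul_one]
    exact MvPolynomial.mem_support_iff.1 hv
  · intro w hw hwv
    rw [coeff_C_mul, coeff_X_pow, if_neg, mul_zero]
    exact fun h => hwv (sum_pow_mul_injOn (by omega) (hlt v hv) (hlt w hw) h).symm
  · exact fun h => absurd hv h

/-- A subalgebra of a polynomial ring of transcendence degree one embeds in `F[X]`. -/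
theorem exists_algHom_polynomial_injective {F R : Type*} [Field F] [CommRing R] [IsDomain R]
    [Algebra F R] {n : ℕ} (f : R →ₐ[F] MvPolynomial (Fin n) F) (hf : Function.Injective f)
    (r : R) (hr : ∀ c : F, r ≠ algebraMap F R c)
    (halg : ∀ x : R, ∃ Q : F[X][X], Q ≠ 0 ∧ Q.eval₂ (aeval r : F[X] →ₐ[F] R).toRingHom x = 0) :
    ∃ g : R →ₐ[F] F[X], Function.Injective g ∧ 0 < (g r).natDegree := by
  obtain ⟨h, hh⟩ := exists_algHom_polynomial_natDegree_pos (f r) (fun c hc => hr c (hf (by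
    rw [hc, AlgHom.commutes, MvPolynomial.algebraMap_eq])))
  refine ⟨h.comp f, ?_, hh⟩
  rw [injective_iff_map_eq_zero]
  intro x hx
  by_contra hx0
  obtain ⟨Q, hQ0, hQ⟩ := halg x
  apply Ideal.comap_ne_bot_of_root_mem (I := RingHom.ker (h.comp f)) hx0 hx hQ0 hQ
  rw [eq_bot_iff]
  intro p hp
  have hp : aeval (h (f r)) p = 0 := by
    have hp : (h.comp f) (aeval r p) = 0 := hp
    rwa [← aeval_algHom_apply] at hp
  rw [← comp_eq_aeval, comp_eq_zero_iff] at hp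
  rcases hp with hp | ⟨-, hp⟩
  · exact hp
  · rw [hp, natDegree_C] at hh
    omega

/-- The Russell–Sathaye criterion: `A` is generated by `s` over `R` if it is so generically and
if `s` is transcendental modulo every prime of `R`. -/
theorem aeval_surjective_of_forall_prime {R B : Type*} [CommRing R] [IsDomain R]
    [UniqueFactorizationMonoid R] [CommRing B] [IsDomain B] [Algebra R B] [FaithfulSMul R B]
    (s : B) (hgen : ∀ a : B, ∃ g : R, g ≠ 0 ∧ g • a ∈ (aeval s : R[X] →ₐ[R] B).range)
    (hs : ∀ p : R, Prime p → ∀ P : R[X], algebraMap R B p ∣ aeval s P → C p ∣ P) :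
    Function.Surjective (aeval s : R[X] →ₐ[R] B) := by
  suffices H : ∀ g : R, g ≠ 0 → ∀ a : B, g • a ∈ (aeval s : R[X] →ₐ[R] B).range →
      a ∈ (aeval s : R[X] →ₐ[R] B).range by
    intro a
    obtain ⟨g, hg, hga⟩ := hgen a
    exact H g hg a hga
  intro g
  induction g using UniqueFactorizationMonoid.induction_on_prime with
  | h₁ => exact fun h => absurd rfl h
  | h₂ u hu =>
    intro _ a ha
    obtain ⟨v, hv⟩ := hu.exists_left_inv
    have := Subalgebra.smul_mem _ ha v
    rwa [smul_smul, hv, one_smul] at this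
  | h₃ g p _ hp ih =>
    rintro hpg a ⟨P, hP⟩
    obtain ⟨Q, rfl⟩ := hs p hp P ⟨g • a, by
      rw [← Algebra.smul_def, smul_smul]
      exact hP⟩
    refine ih (right_ne_zero_of_mul hpg) a ⟨Q, ?_⟩
    have hp0 : algebraMap R B p ≠ 0 := by
      rw [Ne, FaithfulSMul.algebraMap_eq_zero_iff]
      exact hp.ne_zero
    apply mul_left_cancel₀ hp0
    change aeval s (C p * Q) = _ at hP
    rw [map_mul, aeval_C] at hP
    rw [← Algebra.smul_def p (g • a), smul_smul, ← hP]
    rfl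

theorem AlgebraicIndependent.one_tmul {F E B ι : Type*} [Field F] [Field E] [Algebra F E]
    [CommRing B] [Algebra F B] {x : ι → B} (hx : AlgebraicIndependent F x) :
    AlgebraicIndependent E fun i => (1 : E) ⊗ₜ[F] x i := by
  have h : MvPolynomial.aeval (fun i => (1 : E) ⊗ₜ[F] x i) =
      (Algebra.TensorProduct.map (AlgHom.id E E) (MvPolynomial.aeval x)).comp
        (MvPolynomial.algebraTensorAlgEquiv (σ := ι) F E).symm.toAlgHom := by
    apply MvPolynomial.algHom_ext
    intro i
    simp
  rw [AlgebraicIndependent, h]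
  exact (Module.Flat.lTensor_preserves_injective_linearMap (M := E)
    (MvPolynomial.aeval x).toLinearMap hx).comp (AlgEquiv.injective _)

theorem Transcendental.one_tmul {F B : Type*} (E : Type*) [Field F] [Field E] [Algebra F E]
    [CommRing B] [Algebra F B] {x : B} (hx : Transcendental F x) :
    Transcendental E ((1 : E) ⊗ₜ[F] x) := by
  have := AlgebraicIndependent.one_tmul (E := E)
    ((algebraicIndependent_unique_type_iff (ι := Unit) (x := fun _ => x)).2 hx)
  exact algebraicIndependent_unique_type_iff.1 this

theorem dvd_of_one_tmul_dvd {F B : Type*} (E : Type*) [Field F] [Field E] [Algebra F E]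
    [CommRing B] [Algebra F B] {a b : B} (h : (1 : E) ⊗ₜ[F] b ∣ (1 : E) ⊗ₜ[F] a) : b ∣ a := by
  obtain ⟨z, hz⟩ := h
  rw [← Ideal.mem_span_singleton, ← Ideal.Quotient.eq_zero_iff_mem]
  apply Algebra.TensorProduct.includeRight_injective (R := F) (A := E)
    (FaithfulSMul.algebraMap_injective F E)
  have := congrArg (Algebra.TensorProduct.map (AlgHom.id F E)
    (Ideal.Quotient.mkₐ F (Ideal.span {b}))) hz
  rw [map_mul, Algebra.TensorProduct.map_tmul, Algebra.TensorProduct.map_tmul,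
    Ideal.Quotient.mkₐ_eq_mk, Ideal.Quotient.eq_zero_iff_mem.2 (Ideal.mem_span_singleton_self b),
    tmul_zero, zero_mul] at this
  rw [map_zero]
  exact this

/-- A subring of an integrally closed domain which is closed under exact division is
integrally closed. -/
theorem isIntegrallyClosed_of_dvd {R S : Type*} [CommRing R] [IsDomain R] [CommRing S]
    [IsDomain S] [IsIntegrallyClosed S] (j : R →+* S) (hj : Function.Injective j)
    (hdvd : ∀ a b : R, b ≠ 0 → j b ∣ j a → b ∣ a) : IsIntegrallyClosed R := by
  rw [isIntegrallyClosed_iff (FractionRing R)]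
  intro x hx
  obtain ⟨a, b, hb, rfl⟩ := IsFractionRing.div_surjective (A := R) x
  have hb0 : b ≠ 0 := nonZeroDivisors.ne_zero hb
  let J : FractionRing R →+* FractionRing S := IsFractionRing.map hj
  have hJ : ∀ r, J (algebraMap R _ r) = algebraMap S _ (j r) := fun r =>
    IsLocalization.map_eq _ r
  have hint : IsIntegral S (J (algebraMap R _ a / algebraMap R _ b)) := by
    obtain ⟨p, hp, hp0⟩ := hx
    refine ⟨p.map j, hp.map j, ?_⟩
    have hcomp : (algebraMap S (FractionRing S)).comp j =
        J.comp (algebraMap R (FractionRing R)) := RingHom.ext fun r => (hJ r).symm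
    rw [eval₂_map, hcomp, ← hom_eval₂, hp0, map_zero]
  obtain ⟨s, hs⟩ := IsIntegrallyClosed.isIntegral_iff.1 hint
  have hjb : algebraMap S (FractionRing S) (j b) ≠ 0 := by
    rw [Ne, FaithfulSMul.algebraMap_eq_zero_iff, map_eq_zero_iff j hj]
    exact hb0
  rw [map_div₀, hJ, hJ, eq_div_iff hjb, ← map_mul] at hs
  obtain ⟨c, rfl⟩ := hdvd a b hb0 ⟨s, by
    rw [← FaithfulSMul.algebraMap_injective S (FractionRing S) hs, mul_comm]⟩
  refine ⟨c, ?_⟩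
  have hb1 : algebraMap R (FractionRing R) b ≠ 0 := by
    rw [Ne, FaithfulSMul.algebraMap_eq_zero_iff]
    exact hb0
  rw [map_mul, mul_div_cancel_left₀ _ hb1]

/-- Base change of an exponential map, as an algebra homomorphism. -/
noncomputable def ExpMap.baseChange (φ : ExpMap k A) (E : Type*) [Field E] [Algebra k E] :
    E ⊗[k] A →ₐ[E] (E ⊗[k] A)[X] :=
  Algebra.TensorProduct.lift (Algebra.ofId E _)
    ((mapAlgHom Algebra.TensorProduct.includeRight).comp φ.toFun) fun _ _ => Commute.all _ _

namespace ExpMap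

variable (φ : ExpMap k A) (E : Type*) [Field E] [Algebra k E]

theorem coeff_baseChange_tmul (e : E) (a : A) (j : ℕ) :
    (φ.baseChange E (e ⊗ₜ a)).coeff j = e ⊗ₜ (φ.toFun a).coeff j := by
  simp [baseChange, Algebra.ofId_apply]

theorem coeff_zero_baseChange (z : E ⊗[k] A) : (φ.baseChange E z).coeff 0 = z := by
  induction z with
  | zero => simp
  | add x y hx hy => rw [map_add, coeff_add, hx, hy]
  | tmul e a => rw [coeff_baseChange_tmul, coeff_zero_eq_eval_zero, φ.eval_zero]

/-- The invariants of the base change are generated by the invariants. -/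
theorem mem_range_of_natDegree_baseChange_eq_zero {t : A}
    (ht : ∀ a ∈ φ.invariants, a ∈ (aeval t : k[X] →ₐ[k] A).range) {z : E ⊗[k] A}
    (hz : (φ.baseChange E z).natDegree = 0) :
    z ∈ (aeval ((1 : E) ⊗ₜ[k] t) : E[X] →ₐ[E] E ⊗[k] A).range := by
  classical
  let b := Module.Basis.ofVectorSpace k E
  obtain ⟨c, rfl⟩ := TensorProduct.eq_repr_basis_left b z
  have hc : ∀ i, c i ∈ φ.invariants := by
    intro i
    refine φ.mem_invariants_of_natDegree_eq_zero (Nat.le_zero.1 ?_)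
    rw [natDegree_le_iff_coeff_eq_zero]
    intro j hj
    have h : (φ.baseChange E (c.sum fun i n => b i ⊗ₜ n)).coeff j = 0 :=
      coeff_eq_zero_of_natDegree_lt (hz.trans_lt hj)
    rw [Finsupp.sum, map_sum, finsetSum_coeff] at h
    simp only [coeff_baseChange_tmul] at h
    let d : _ →₀ A := c.mapRange (fun a => (φ.toFun a).coeff j) (by simp)
    have hd : d = 0 := by
      apply TensorProduct.sum_tmul_basis_left_eq_zero b
      rw [Finsupp.sum_mapRange_index (by simp)]
      exact h
    exact DFunLike.congr_fun hd i
  refine sum_mem fun i _ => ?_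
  obtain ⟨p, hp⟩ := ht _ (hc i)
  refine ⟨C (b i) * p.map (algebraMap k E), ?_⟩
  have h1 : aeval ((1 : E) ⊗ₜ[k] t) (p.map (algebraMap k E)) = (1 : E) ⊗ₜ[k] c i := by
    rw [aeval_map_algebraMap, ← hp]
    exact aeval_algHom_apply (Algebra.TensorProduct.includeRight : A →ₐ[k] E ⊗[k] A) t p
  change aeval _ (C (b i) * _) = _
  rw [map_mul, aeval_C, h1, Algebra.TensorProduct.algebraMap_apply,
    Algebra.TensorProduct.tmul_mul_tmul]
  simp

theorem mem_range_of_mul_eq [IsDomain (E ⊗[k] A)] {t : A}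
    (htR : t ∈ φ.invariants)
    (ht : ∀ a ∈ φ.invariants, a ∈ (aeval t : k[X] →ₐ[k] A).range) {z w : E ⊗[k] A} {c : E}
    (h : (1 : E) ⊗ₜ[k] t - c ⊗ₜ 1 = z * w) (h0 : z * w ≠ 0) :
    z ∈ (aeval ((1 : E) ⊗ₜ[k] t) : E[X] →ₐ[E] E ⊗[k] A).range := by
  apply φ.mem_range_of_natDegree_baseChange_eq_zero E ht
  have hne : ∀ x, x ≠ 0 → φ.baseChange E x ≠ 0 := by
    intro x hx hx0
    rw [← φ.coeff_zero_baseChange E x, hx0, coeff_zero] at hx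
    exact hx rfl
  have hd : (φ.baseChange E (z * w)).natDegree = 0 := by
    rw [← h, ← Nat.le_zero, natDegree_le_iff_coeff_eq_zero]
    intro j hj
    rw [map_sub, coeff_sub, coeff_baseChange_tmul, coeff_baseChange_tmul, map_one,
      φ.mem_invariants.1 htR, coeff_C, if_neg hj.ne', coeff_one, if_neg hj.ne']
    simp
  rw [map_mul, natDegree_mul (hne _ (left_ne_zero_of_mul h0)) (hne _ (right_ne_zero_of_mul h0))]
    at hd
  omega

theorem prime_one_tmul_sub [IsDomain (E ⊗[k] A)] [UniqueFactorizationMonoid (E ⊗[k] A)] {t : A}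
    (htR : t ∈ φ.invariants) (htr : Transcendental k t)
    (ht : ∀ a ∈ φ.invariants, a ∈ (aeval t : k[X] →ₐ[k] A).range) (c : E) :
    Prime ((1 : E) ⊗ₜ[k] t - c ⊗ₜ 1) := by
  have hinj : Function.Injective (aeval ((1 : E) ⊗ₜ[k] t) : E[X] →ₐ[E] E ⊗[k] A) :=
    transcendental_iff_injective.1 (htr.one_tmul E)
  have hX : aeval ((1 : E) ⊗ₜ[k] t) (X - C c) = (1 : E) ⊗ₜ[k] t - c ⊗ₜ 1 := by
    rw [map_sub, aeval_X, aeval_C, Algebra.TensorProduct.algebraMap_apply]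
    rfl
  have h0 : (1 : E) ⊗ₜ[k] t - c ⊗ₜ 1 ≠ 0 := by
    rw [← hX, Ne, map_eq_zero_iff _ hinj]
    exact X_sub_C_ne_zero c
  rw [← UniqueFactorizationMonoid.irreducible_iff_prime, irreducible_iff]
  constructor
  · intro hu
    obtain ⟨w, hw⟩ := hu.exists_right_inv
    have hw' : (1 : E) ⊗ₜ[k] t - c ⊗ₜ 1 = (((1 : E) ⊗ₜ[k] t - c ⊗ₜ 1) ^ 2) * w := by
      rw [pow_two, mul_assoc, hw, mul_one]
    obtain ⟨Q, rfl⟩ := φ.mem_range_of_mul_eq E htR ht (hw'.trans (mul_comm _ _))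
      (by rwa [mul_comm, ← hw'])
    change _ * aeval _ Q = 1 at hw
    rw [← hX, ← map_mul,
      ← map_one (aeval ((1 : E) ⊗ₜ[k] t) : E[X] →ₐ[E] E ⊗[k] A), hinj.eq_iff] at hw
    exact (irreducible_X_sub_C c).not_isUnit (IsUnit.of_mul_eq_one _ hw)
  · intro z w h
    obtain ⟨P, rfl⟩ := φ.mem_range_of_mul_eq E htR ht h (by rwa [← h])
    obtain ⟨Q, rfl⟩ := φ.mem_range_of_mul_eq E htR ht (h.trans (mul_comm _ _))
      (by rwa [mul_comm, ← h])
    change _ = aeval _ P * aeval _ Q at h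
    rw [← hX, ← map_mul, hinj.eq_iff] at h
    exact ((irreducible_X_sub_C c).isUnit_or_isUnit h).imp (fun h => h.map _) fun h => h.map _

end ExpMap

/-- Residues modulo `p(t)` which become constant after base change to `E` at a root `c` of `p`
are represented by polynomials in `t`. -/
theorem exists_dvd_sub_aeval_of_one_tmul {F E B : Type*} [Field F] [Field E] [Algebra F E]
    [CommRing B] [Algebra F B] (t : B) {p : F[X]} (hp : Irreducible p) {c α : E}
    (hc : aeval c p = 0) {a : B}
    (h : (1 : E) ⊗ₜ[F] t - c ⊗ₜ 1 ∣ (1 : E) ⊗ₜ[F] a - α ⊗ₜ 1) :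
    ∃ q : F[X], aeval t p ∣ a - aeval t q := by
  let : Algebra F[X] B := (aeval t : F[X] →ₐ[F] B).toAlgebra
  have halg : ∀ q : F[X], algebraMap F[X] B q = aeval t q := fun _ => rfl
  let I : Ideal F[X] := Ideal.span {p}
  have : I.IsMaximal := PrincipalIdealRing.isMaximal_of_irreducible hp
  let : Field (F[X] ⧸ I) := Ideal.Quotient.field I
  let J : Ideal B := I.map (algebraMap F[X] B)
  have hJ : J = Ideal.span {aeval t p} := by
    simp only [J, I, Ideal.map_span, Set.image_singleton, halg]
  by_cases hmem : Ideal.Quotient.mk J a ∈ Submodule.span (F[X] ⧸ I) {(1 : B ⧸ J)}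
  · obtain ⟨x, hx⟩ := Submodule.mem_span_singleton.1 hmem
    obtain ⟨q, rfl⟩ := Ideal.Quotient.mk_surjective x
    refine ⟨q, ?_⟩
    rw [← Ideal.mem_span_singleton, ← hJ, ← Ideal.Quotient.eq, ← hx, Algebra.smul_def, mul_one]
    rfl
  exfalso
  obtain ⟨l, hl, hl1⟩ := Submodule.exists_le_ker_of_notMem hmem
  have hl1 : l 1 = 0 := hl1 (Submodule.mem_span_singleton_self _)
  let ι : F[X] ⧸ I →+* E := Ideal.Quotient.lift I (aeval c : F[X] →ₐ[F] E).toRingHom (by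
    intro q hq
    obtain ⟨w, rfl⟩ := Ideal.mem_span_singleton.1 hq
    change aeval c (p * w) = 0
    rw [map_mul, hc, zero_mul])
  have hι : ∀ q, ι (Ideal.Quotient.mk I q) = aeval c q := fun _ => rfl
  have hmul : ∀ (q : F[X]) (b : B),
      ι (l (Ideal.Quotient.mk J (aeval t q * b))) =
        aeval c q * ι (l (Ideal.Quotient.mk J b)) := by
    intro q b
    have : Ideal.Quotient.mk J (aeval t q * b) =
        Ideal.Quotient.mk I q • Ideal.Quotient.mk J b := by
      rw [Algebra.smul_def, map_mul]
      rfl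
    rw [this, map_smul, smul_eq_mul, map_mul, hι]
  let ℓ : B →ₗ[F] E :=
    { toFun := fun b => ι (l (Ideal.Quotient.mk J b))
      map_add' := fun x y => by simp only [map_add]
      map_smul' := fun r x => by
        have := hmul (C r) x
        rw [aeval_C, aeval_C, ← Algebra.smul_def, ← Algebra.smul_def] at this
        exact this }
  let Λ : E ⊗[F] B →ₗ[F] E := (LinearMap.mul' F E).comp (ℓ.lTensor E)
  have hΛ : ∀ (e : E) (b : B), Λ (e ⊗ₜ b) = e * ι (l (Ideal.Quotient.mk J b)) := fun _ _ => rfl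
  have hkill : ∀ z, Λ (((1 : E) ⊗ₜ[F] t - c ⊗ₜ 1) * z) = 0 := by
    intro z
    induction z with
    | zero => simp
    | add x y hx hy => rw [mul_add, map_add, hx, hy, add_zero]
    | tmul e b =>
      have := hmul X b
      rw [aeval_X, aeval_X] at this
      rw [sub_mul, Algebra.TensorProduct.tmul_mul_tmul, Algebra.TensorProduct.tmul_mul_tmul,
        map_sub, hΛ, hΛ, this, one_mul, one_mul]
      ring
  obtain ⟨z, hz⟩ := h
  have h0 := hkill z
  rw [← hz, map_sub, hΛ, hΛ, map_one, hl1, map_zero, mul_zero, sub_zero, one_mul,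
    map_eq_zero] at h0
  exact hl h0

/-- An element of `B` which is algebraic modulo `p(t)` is congruent to a polynomial in `t`,
provided that `t - c` is prime after base change to an algebraically closed field. -/
theorem exists_dvd_sub_aeval {F E B : Type*} [Field F] [Field E] [Algebra F E] [IsAlgClosed E]
    [CommRing B] [Algebra F B] (t : B)
    (hprime : ∀ c : E, Prime ((1 : E) ⊗ₜ[F] t - c ⊗ₜ 1)) {p : F[X]} (hp : Irreducible p)
    {a : B} {P : F[X][X]} (hP : ¬ C p ∣ P)
    (h : aeval t p ∣ P.eval₂ (aeval t : F[X] →ₐ[F] B).toRingHom a) :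
    ∃ q : F[X], aeval t p ∣ a - aeval t q := by
  obtain ⟨c, hc⟩ := IsAlgClosed.exists_aeval_eq_zero E p (degree_pos_of_irreducible hp).ne'
  have hPc : P.map (aeval c : F[X] →ₐ[F] E).toRingHom ≠ 0 := by
    intro h0
    refine hP ((C_dvd_iff_dvd_coeff _ _).2 fun i => ?_)
    have hi := congrArg (fun q => q.coeff i) h0
    simp only [coeff_map, coeff_zero] at hi
    have hci : IsIntegral F c := IsAlgebraic.isIntegral ⟨p, hp.ne_zero, hc⟩
    exact ((minpoly.irreducible hci).associated_of_dvd hp (minpoly.dvd F c hc)).symm.dvd.trans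
      (minpoly.dvd F c hi)
  let I : Ideal (E ⊗[F] B) := Ideal.span {(1 : E) ⊗ₜ[F] t - c ⊗ₜ 1}
  have : I.IsPrime := (Ideal.span_singleton_prime (hprime c).ne_zero).2 (hprime c)
  let π : E ⊗[F] B →ₐ[E] E ⊗[F] B ⧸ I := Ideal.Quotient.mkₐ E I
  let θ : B →ₐ[F] E ⊗[F] B ⧸ I :=
    (π.restrictScalars F).comp Algebra.TensorProduct.includeRight
  have hθ : ∀ b, θ b = π (1 ⊗ₜ b) := fun _ => rfl
  have hθt : θ t = algebraMap E _ c := by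
    rw [hθ, ← π.commutes, ← sub_eq_zero, ← map_sub]
    exact Ideal.Quotient.eq_zero_iff_mem.2 (Ideal.mem_span_singleton_self _)
  have hcomp : θ.toRingHom.comp (aeval t : F[X] →ₐ[F] B).toRingHom =
      (algebraMap E (E ⊗[F] B ⧸ I)).comp (aeval c : F[X] →ₐ[F] E).toRingHom := by
    have : θ.comp (aeval t) = (Algebra.ofId E (E ⊗[F] B ⧸ I) |>.restrictScalars F).comp
        (aeval c : F[X] →ₐ[F] E) := by
      apply Polynomial.algHom_ext
      simp [hθt, Algebra.ofId_apply]
    exact congrArg AlgHom.toRingHom this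
  have halg : aeval (θ a) (P.map (aeval c : F[X] →ₐ[F] E).toRingHom) = 0 := by
    rw [aeval_def, eval₂_map, ← hcomp]
    have h1 := hom_eval₂ P (aeval t : F[X] →ₐ[F] B).toRingHom θ.toRingHom a
    refine h1.symm.trans ?_
    obtain ⟨w, hw⟩ := h
    rw [hw]
    change θ (aeval t p * w) = 0
    rw [map_mul]
    have : θ (aeval t p) = algebraMap E _ (aeval c p) := RingHom.congr_fun hcomp p
    rw [this, hc, map_zero, zero_mul]
  have hint : IsIntegral E (θ a) := IsAlgebraic.isIntegral ⟨_, hPc, halg⟩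
  obtain ⟨α, hα⟩ := minpoly.mem_range_of_degree_eq_one E (θ a)
    (IsAlgClosed.degree_eq_one_of_irreducible E (minpoly.irreducible hint))
  refine exists_dvd_sub_aeval_of_one_tmul t hp hc (α := α) ?_
  rw [← Ideal.mem_span_singleton]
  rw [← π.commutes, hθ, eq_comm, ← sub_eq_zero, ← map_sub] at hα
  exact Ideal.Quotient.eq_zero_iff_mem.1 hα

theorem trdeg_le_of_algEquiv_mvPolynomial {F E B ι : Type*} [Field F] [Field E] [Algebra F E]
    [CommRing B] [IsDomain B] [Algebra F B] [Fintype ι]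
    (e : (E ⊗[F] B) ≃ₐ[E] MvPolynomial ι E) : Algebra.trdeg F B ≤ Fintype.card ι := by
  obtain ⟨κ, x, hx⟩ := exists_isTranscendenceBasis' F B
  have h1 := ((hx.1.one_tmul (E := E)).map' (f := e.toAlgHom) e.injective).lift_cardinalMk_le_trdeg
  rw [MvPolynomial.trdeg_of_isDomain] at h1
  rw [Cardinal.lift_lift, Cardinal.mk_fintype ι, Cardinal.lift_natCast,
    Cardinal.lift_le_nat_iff] at h1
  have h2 := hx.lift_cardinalMk_eq_trdeg
  rw [Cardinal.lift_id, Cardinal.lift_id] at h2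
  rwa [← h2]

theorem not_surjective_aeval_of_algEquiv_mvPolynomial {F E B : Type*} [Field F] [Field E]
    [Algebra F E] [CommRing B] [Algebra F B]
    (e : (E ⊗[F] B) ≃ₐ[E] MvPolynomial (Fin 2) E) (s : B) :
    ¬ Function.Surjective (aeval s : F[X] →ₐ[F] B) := by
  intro hs
  have hs' : Function.Surjective (aeval ((1 : E) ⊗ₜ[F] s) : E[X] →ₐ[E] E ⊗[F] B) := by
    intro z
    change z ∈ (aeval ((1 : E) ⊗ₜ[F] s) : E[X] →ₐ[E] E ⊗[F] B).range
    induction z with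
    | zero => exact zero_mem _
    | add x y hx hy => exact add_mem hx hy
    | tmul c b =>
      obtain ⟨p, rfl⟩ := hs b
      refine ⟨C c * p.map (algebraMap F E), ?_⟩
      have h1 : aeval ((1 : E) ⊗ₜ[F] s) (p.map (algebraMap F E)) = (1 : E) ⊗ₜ[F] aeval s p := by
        rw [aeval_map_algebraMap]
        exact aeval_algHom_apply (Algebra.TensorProduct.includeRight : B →ₐ[F] E ⊗[F] B) s p
      change aeval _ (C c * _) = _
      rw [map_mul, aeval_C, h1, Algebra.TensorProduct.algebraMap_apply,
        Algebra.TensorProduct.tmul_mul_tmul]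
      simp
  have := trdeg_le_of_surjective (e.toAlgHom.comp (aeval ((1 : E) ⊗ₜ[F] s)))
    (e.surjective.comp hs')
  rw [MvPolynomial.trdeg_of_isDomain, Polynomial.trdeg_of_isDomain] at this
  simp at this

theorem nonempty_algEquiv_tensorProduct_of_tower {F L B ι : Type*} (E : Type*) [Field F] [Field L]
    [Field E] [Algebra F L] [Algebra F E] [Algebra L E] [IsScalarTower F L E] [CommRing B]
    [Algebra F B] (e : (L ⊗[F] B) ≃ₐ[L] MvPolynomial ι L) :
    Nonempty ((E ⊗[F] B) ≃ₐ[E] MvPolynomial ι E) :=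
  ⟨(Algebra.TensorProduct.cancelBaseChange F L E E B).symm.trans
    ((Algebra.TensorProduct.congr AlgEquiv.refl e).trans
      (MvPolynomial.algebraTensorAlgEquiv L E))⟩

namespace ExpMap

theorem transcendental_of_notMem_invariants [IsDomain A] (φ : ExpMap k A) {s : A}
    (hs : s ∉ φ.invariants) : Transcendental φ.invariants s := by
  rw [transcendental_iff]
  intro P hP
  have hφ : (C.comp (algebraMap φ.invariants A) : φ.invariants →+* A[X]) =
      φ.toFun.toRingHom.comp (algebraMap φ.invariants A) := RingHom.ext fun r => r.2.symm
  have h0 : (P.map (algebraMap φ.invariants A)).comp (φ.toFun s) = 0 := by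
    rw [comp, eval₂_map, hφ]
    refine (hom_eval₂ P _ φ.toFun.toRingHom s).symm.trans ?_
    rw [← aeval_def, hP, map_zero]
  rcases comp_eq_zero_iff.1 h0 with h | ⟨-, h⟩
  · exact (Polynomial.map_eq_zero_iff Subtype.val_injective).1 h
  · exact absurd (mem_invariants_of_eq_C φ h) hs

theorem isIntegrallyClosed_invariants [IsDomain A] (φ : ExpMap k A) (E : Type*) [Field E]
    [Algebra k E] [IsDomain (E ⊗[k] A)] [IsIntegrallyClosed (E ⊗[k] A)] :
    IsIntegrallyClosed φ.invariants := by
  refine isIntegrallyClosed_of_dvd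
    ((Algebra.TensorProduct.includeRight : A →ₐ[k] E ⊗[k] A).comp φ.invariants.val).toRingHom
    ((Algebra.TensorProduct.includeRight_injective (algebraMap k E).injective).comp
      Subtype.val_injective) fun a b hb h => ?_
  obtain ⟨c, hc⟩ := dvd_of_one_tmul_dvd E h
  have hb' : (b : A) ≠ 0 := fun h0 => hb (Subtype.ext h0)
  have hcR : c ∈ φ.invariants :=
    φ.mem_invariants_of_mul_mem hb' (by rw [← show (a : A) = b * c from hc]; exact a.2) b.2
  exact ⟨⟨c, hcR⟩, Subtype.ext hc⟩

theorem trdeg_invariants_le_one [IsDomain A] (φ : ExpMap k A) (hφ : φ.Nontrivial)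
    (h : Algebra.trdeg k A ≤ 2) : Algebra.trdeg k φ.invariants ≤ 1 := by
  obtain ⟨s, hs⟩ := hφ
  have htr : Algebra.Transcendental φ.invariants A :=
    ⟨s, φ.transcendental_of_notMem_invariants hs⟩
  have h1 : 1 ≤ Algebra.trdeg φ.invariants A :=
    Cardinal.one_le_iff_pos.2 (trdeg_pos φ.invariants A)
  rw [← trdeg_add_eq k φ.invariants] at h
  have h2 := (add_le_add_right h1 (Algebra.trdeg k φ.invariants)).trans h
  rw [← one_add_one_eq_two] at h2
  exact Cardinal.add_one_le_add_one_iff.1 h2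

end ExpMap

theorem exists_eval₂_aeval_eq_zero {F R : Type*} [Field F] [CommRing R] [IsDomain R]
    [Algebra F R] (h : Algebra.trdeg F R ≤ 1) {r : R} (hr : Transcendental F r) (x : R) :
    ∃ Q : F[X][X], Q ≠ 0 ∧ Q.eval₂ (aeval r : F[X] →ₐ[F] R).toRingHom x = 0 := by
  let : Algebra F[X] R := (aeval r : F[X] →ₐ[F] R).toAlgebra
  have : IsScalarTower F F[X] R := IsScalarTower.of_algebraMap_eq fun c => (aeval_C r c).symm
  have : FaithfulSMul F[X] R :=
    (faithfulSMul_iff_algebraMap_injective F[X] R).2 (transcendental_iff_injective.1 hr)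
  have h1 := lift_trdeg_add_eq F F[X] R
  rw [Polynomial.trdeg_of_isDomain] at h1
  have h2 := Cardinal.lift_le_one_iff.2 h
  rw [← h1, Cardinal.lift_one, add_comm, ← zero_add (1 : Cardinal), ← add_assoc, add_zero,
    Cardinal.add_one_le_add_one_iff, nonpos_iff_eq_zero, Cardinal.lift_eq_zero,
    trdeg_eq_zero_iff] at h2
  exact Algebra.IsAlgebraic.isAlgebraic x

namespace ExpMap

theorem exists_bijective_aeval_invariants [IsDomain A] (φ : ExpMap k A) (hφ : φ.Nontrivial)
    [IsIntegrallyClosed φ.invariants] (hd : Algebra.trdeg k A ≤ 2) {n : ℕ}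
    (f : A →ₐ[k] MvPolynomial (Fin n) k) (hf : Function.Injective f) {r : A}
    (hrφ : r ∈ φ.invariants) (hr : ∀ c : k, r ≠ algebraMap k A c) :
    ∃ t : φ.invariants, Transcendental k (t : A) ∧
      Function.Bijective (aeval t : k[X] →ₐ[k] φ.invariants) := by
  have hfR : Function.Injective (f.comp φ.invariants.val) := hf.comp Subtype.val_injective
  obtain ⟨h, hh⟩ := exists_algHom_polynomial_natDegree_pos (f r) fun c hc => hr c (hf (by
    rw [hc, AlgHom.commutes, MvPolynomial.algebraMap_eq]))
  have hrtr : Transcendental k (⟨r, hrφ⟩ : φ.invariants) := fun halg =>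
    Polynomial.transcendental (h (f r)) hh.ne'
      (mem_nonZeroDivisors_of_ne_zero
        (leadingCoeff_ne_zero.2 (ne_zero_of_natDegree_gt hh)))
      (halg.algHom (h.comp (f.comp φ.invariants.val)))
  obtain ⟨g, hg, hgr⟩ := exists_algHom_polynomial_injective (f.comp φ.invariants.val) hfR
    ⟨r, hrφ⟩ (fun c hc => hr c (congrArg Subtype.val hc))
    (exists_eval₂_aeval_eq_zero (φ.trdeg_invariants_le_one hφ hd) hrtr)
  let : Algebra φ.invariants k[X] := g.toAlgebra
  have : IsScalarTower k φ.invariants k[X] :=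
    IsScalarTower.of_algebraMap_eq fun c => (g.commutes c).symm
  have : FaithfulSMul φ.invariants k[X] := (faithfulSMul_iff_algebraMap_injective _ _).2 hg
  obtain ⟨t, -, ht⟩ := exists_bijective_aeval_of_isIntegrallyClosed (F := k) _ hgr
  exact ⟨t, (transcendental_algebraMap_iff (R := k) (S := φ.invariants) (A := A)
    Subtype.val_injective).2 (transcendental_iff_injective.2 ht.1), ht⟩

theorem exists_mem_invariants_ne_algebraMap [IsDomain A] (φ : ExpMap k A) (hφ : φ.Nontrivial)
    (h : ∀ s : A, ¬ Function.Surjective (aeval s : k[X] →ₐ[k] A)) :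
    ∃ r ∈ φ.invariants, ∀ c : k, r ≠ algebraMap k A c := by
  by_contra! hcon
  obtain ⟨s, -, hs⟩ := φ.exists_local_slice hφ
  refine h s fun a => ?_
  obtain ⟨g, hg, hg0, P, hP⟩ := hs a
  obtain ⟨c, rfl⟩ := hcon g hg
  have hc : c ≠ 0 := fun h0 => hg0 (by rw [h0, map_zero])
  have hPmem : aeval s P ∈ (aeval s : k[X] →ₐ[k] A).range := by
    rw [aeval_eq_sum_range]
    refine sum_mem fun i _ => ?_
    obtain ⟨d, hd⟩ := hcon _ (P.coeff i).2
    refine ⟨C d * X ^ i, ?_⟩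
    change aeval s (C d * X ^ i) = _
    rw [map_mul, aeval_C, map_pow, aeval_X, ← hd]
    rfl
  have := Subalgebra.smul_mem _ hPmem c⁻¹
  rwa [hP, ← Algebra.smul_def, smul_smul, inv_mul_cancel₀ hc, one_smul] at this

theorem nonempty_algEquiv_of_bijective_aeval [IsDomain A] (φ : ExpMap k A) (hφ : φ.Nontrivial)
    {E : Type*} [Field E] [IsAlgClosed E] [Algebra k E] {n : ℕ}
    (f : A →ₐ[k] MvPolynomial (Fin n) k) (hf : Function.Injective f) {t : φ.invariants}
    (htr : Transcendental k (t : A))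
    (ht : Function.Bijective (aeval t : k[X] →ₐ[k] φ.invariants))
    (hprime : ∀ c : E, Prime ((1 : E) ⊗ₜ[k] (t : A) - c ⊗ₜ 1)) :
    Nonempty (k[X][X] ≃ₐ[k] A) := by
  let : Algebra k[X] A := (aeval (t : A) : k[X] →ₐ[k] A).toAlgebra
  have halg : ∀ q : k[X], algebraMap k[X] A q = aeval (t : A) q := fun _ => rfl
  have hinj : Function.Injective (aeval (t : A) : k[X] →ₐ[k] A) :=
    transcendental_iff_injective.1 htr
  have : IsScalarTower k k[X] A := IsScalarTower.of_algebraMap_eq fun c => (aeval_C _ c).symm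
  have : FaithfulSMul k[X] A := (faithfulSMul_iff_algebraMap_injective k[X] A).2 hinj
  have hcoe : ∀ q : k[X], ((aeval t q : φ.invariants) : A) = aeval (t : A) q := fun q =>
    (aeval_algHom_apply φ.invariants.val t q).symm
  have hmem : ∀ q : k[X], aeval (t : A) q ∈ φ.invariants := fun q => by
    rw [← hcoe]
    exact (aeval t q).2
  obtain ⟨s₀, hs₀, hgen₀⟩ := φ.exists_local_slice hφ
  obtain ⟨i, hi0, hi⟩ : ∃ i, i ≠ 0 ∧ (φ.toFun s₀).coeff i ≠ 0 := by
    by_contra! hcon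
    refine hs₀ (φ.mem_invariants_of_eq_C (b := (φ.toFun s₀).coeff 0) ?_)
    ext i
    rcases eq_or_ne i 0 with rfl | hi
    · rw [coeff_C_zero]
    · rw [coeff_C_of_ne_zero hi, hcon i hi]
  suffices H : ∀ N : ℕ, ∀ s : A, (f ((φ.toFun s).coeff i)).totalDegree = N →
      (φ.toFun s).coeff i ≠ 0 →
      (∀ a : A, ∃ g : k[X], g ≠ 0 ∧ g • a ∈ (aeval s : k[X][X] →ₐ[k[X]] A).range) →
      ∃ s : A, (φ.toFun s).coeff i ≠ 0 ∧
        Function.Surjective (aeval s : k[X][X] →ₐ[k[X]] A) by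
    obtain ⟨s, hsi, hs⟩ := H _ s₀ rfl hi fun a => by
      obtain ⟨g, hg, hg0, P, hP⟩ := hgen₀ a
      obtain ⟨q, hq⟩ := ht.2 ⟨g, hg⟩
      have hq' : aeval (t : A) q = g := by rw [← hcoe, hq]
      refine ⟨q, fun h0 => hg0 (by rw [← hq', h0, map_zero]), ?_⟩
      rw [Algebra.smul_def, halg, hq', ← hP, aeval_eq_sum_range]
      refine sum_mem fun j _ => ?_
      obtain ⟨d, hd⟩ := ht.2 (P.coeff j)
      refine ⟨C d * X ^ j, ?_⟩
      change aeval s₀ (C d * X ^ j) = _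
      rw [map_mul, aeval_C, map_pow, aeval_X, halg, ← hcoe, hd]
      rfl
    have hsφ : s ∉ φ.invariants := fun h => hsi (by
      rw [φ.mem_invariants.1 h, coeff_C_of_ne_zero hi0])
    have hsinj : Function.Injective (aeval s : k[X][X] →ₐ[k[X]] A) := by
      rw [injective_iff_map_eq_zero]
      intro P hP
      have h0 : aeval s (P.map (aeval t : k[X] →ₐ[k] φ.invariants).toRingHom) = 0 := by
        rw [← hP, aeval_def, eval₂_map, aeval_def]
        congr 1
        exact RingHom.ext hcoe
      exact (Polynomial.map_eq_zero_iff ht.1).1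
        (transcendental_iff.1 (φ.transcendental_of_notMem_invariants hsφ) _ h0)
    exact ⟨(AlgEquiv.ofBijective _ ⟨hsinj, hs⟩).restrictScalars k⟩
  intro N
  induction N using Nat.strong_induction_on with
  | _ N ih =>
  intro s hN hsi hgen
  by_cases hs : ∀ p : k[X], Prime p → ∀ P : k[X][X],
      algebraMap k[X] A p ∣ aeval s P → C p ∣ P
  · exact ⟨s, hsi, aeval_surjective_of_forall_prime s hgen hs⟩
  push Not at hs
  obtain ⟨p, hp, P, hdvd, hP⟩ := hs
  obtain ⟨q, s', hs'⟩ := exists_dvd_sub_aeval (t : A) hprime hp.irreducible hP hdvd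
  rw [sub_eq_iff_eq_add] at hs'
  have hcoeff : (φ.toFun s).coeff i = aeval (t : A) p * (φ.toFun s').coeff i := by
    rw [hs', map_add, map_mul, φ.mem_invariants.1 (hmem p), φ.mem_invariants.1 (hmem q),
      coeff_add, coeff_C_mul, coeff_C_of_ne_zero hi0, add_zero]
  have hsi' : (φ.toFun s').coeff i ≠ 0 := fun h0 => hsi (by rw [hcoeff, h0, mul_zero])
  have hpt : aeval (t : A) p ≠ 0 := fun h0 => hsi (by rw [hcoeff, h0, zero_mul])
  have hdeg : (f (aeval (t : A) p)).totalDegree ≠ 0 := by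
    intro h0
    rw [MvPolynomial.totalDegree_eq_zero_iff_eq_C, ← MvPolynomial.algebraMap_eq,
      ← f.commutes] at h0
    have h1 := hinj ((hf h0).trans (aeval_C (t : A) _).symm)
    refine hp.irreducible.natDegree_pos.ne' ?_
    rw [h1, natDegree_C]
  refine ih _ ?_ s' rfl hsi' fun a => ?_
  · rw [← hN, hcoeff, map_mul, MvPolynomial.totalDegree_mul_of_isDomain
      ((map_ne_zero_iff f hf).2 hpt) ((map_ne_zero_iff f hf).2 hsi')]
    omega
  · obtain ⟨g, hg, hga⟩ := hgen a
    refine ⟨g, hg, ?_⟩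
    have hle : (aeval s : k[X][X] →ₐ[k[X]] A).range ≤ (aeval s' : k[X][X] →ₐ[k[X]] A).range := by
      rw [← Algebra.adjoin_singleton_eq_range_aeval, Algebra.adjoin_le_iff,
        Set.singleton_subset_iff]
      refine ⟨C p * X + C q, ?_⟩
      change aeval s' (C p * X + C q) = s
      rw [map_add, map_mul, aeval_C, aeval_C, aeval_X, hs', halg, halg]
    exact hle hga

end ExpMap
/-- A non-rigid `𝔸²`-form over `k` which embeds as a `k`-subalgebra of a
polynomial ring `k^{[n]}` (`n ≥ 2`) is isomorphic to `k^{[2]}`. -/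
theorem form_inside_poly_ring (L : Type*) [Field L] [Algebra k L]
    (hform : Nonempty ((TensorProduct k L A) ≃ₐ[L] MvPolynomial (Fin 2) L))
    (hnr : ∃ φ : ExpMap k A, φ.Nontrivial)
    (n : ℕ) (hn : 2 ≤ n) (f : A →ₐ[k] MvPolynomial (Fin n) k) (hf : Function.Injective f) :
    Nonempty (A ≃ₐ[k] MvPolynomial (Fin 2) k) := by
  obtain ⟨e₀⟩ := hform
  obtain ⟨φ, hφ⟩ := hnr
  have : IsDomain A := hf.isDomain f.toRingHom
  obtain ⟨e⟩ := nonempty_algEquiv_tensorProduct_of_tower (AlgebraicClosure L) e₀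
  have : IsDomain (AlgebraicClosure L ⊗[k] A) := e.toMulEquiv.isDomain _
  have : UniqueFactorizationMonoid (AlgebraicClosure L ⊗[k] A) :=
    e.symm.toMulEquiv.uniqueFactorizationMonoid inferInstance
  have hR : IsIntegrallyClosed φ.invariants :=
    φ.isIntegrallyClosed_invariants (AlgebraicClosure L)
  obtain ⟨r, hrφ, hr⟩ := φ.exists_mem_invariants_ne_algebraMap hφ
    (not_surjective_aeval_of_algEquiv_mvPolynomial e)
  obtain ⟨t, htr, ht⟩ := φ.exists_bijective_aeval_invariants hφ
    (by simpa using trdeg_le_of_algEquiv_mvPolynomial e) f hf hrφ hr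
  have hrange : ∀ a ∈ φ.invariants, a ∈ (aeval (t : A) : k[X] →ₐ[k] A).range := fun a ha => by
    obtain ⟨q, hq⟩ := ht.2 ⟨a, ha⟩
    exact ⟨q, (aeval_algHom_apply φ.invariants.val t q).trans (congrArg Subtype.val hq)⟩
  obtain ⟨e'⟩ := φ.nonempty_algEquiv_of_bijective_aeval hφ f hf htr ht
    (φ.prime_one_tmul_sub (E := AlgebraicClosure L) t.2 htr hrange)
  exact ⟨e'.symm.trans ((mapAlgEquiv (MvPolynomial.uniqueAlgEquiv k (Fin 1)).symm).trans
    (MvPolynomial.finSuccEquiv k 1).symm)⟩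
end

section
/- Let k be a field and A an 𝔸²-form over k with respect to a field extension L/k such that: (i) A is a unique factorization domain, (ii) A has a k-rational point (equivalently a k-algebra retraction A → k), and (iii) A is non-rigid (admits a nontrivial exponential map). Then A ≅ k^{[2]}. -/
variable {k A : Type*} [Field k] [CommRing A] [Algebra k A]

section
open Polynomial

/-- The coefficients of `φ` form a locally finite iterative higher derivation. -/
structure IsIterative (φ : A →ₐ[k] A[X]) : Prop where
  coeff_zero : ∀ a, (φ a).coeff 0 = a
  coeff_coeff : ∀ a i j, (φ ((φ a).coeff i)).coeff j = ((i + j).choose i : A) * (φ a).coeff (i + j)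

/-- The subalgebra of elements fixed by a coaction. -/
noncomputable def fixedSubalgebra (φ : A →ₐ[k] A[X]) : Subalgebra k A :=
  AlgHom.equalizer φ CAlgHom

theorem mem_fixedSubalgebra {φ : A →ₐ[k] A[X]} {a : A} :
    a ∈ fixedSubalgebra φ ↔ φ a = C a := Iff.rfl

theorem ExpMap.isIterative (φ : ExpMap k A) : IsIterative φ.toFun where
  coeff_zero a := by rw [coeff_zero_eq_eval_zero, φ.eval_zero]
  coeff_coeff a i j := by
    have h := congrArg (fun p : A[X][X] => (p.coeff i).coeff j) (φ.coaction a)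
    simp only [coeff_map] at h
    refine Eq.trans h ?_
    rw [eval₂_eq_sum_range, finsetSum_coeff, finsetSum_coeff]
    have key : ∀ m, (((C.comp C) ((φ.toFun a).coeff m) * (X + C (X : A[X])) ^ m : A[X][X]).coeff
        i).coeff j = if m = i + j then ((m.choose i : ℕ) : A) * (φ.toFun a).coeff m else 0 := by
      intro m
      rw [RingHom.comp_apply, coeff_C_mul, coeff_C_mul, coeff_X_add_C_pow, ← C_eq_natCast,
        mul_comm (X ^ _), coeff_C_mul, coeff_X_pow]
      by_cases hm : m = i + j
      · subst hm
        simp [mul_comm]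
      · rw [if_neg hm]
        by_cases hj : j = m - i
        · have : m < i := by omega
          simp [Nat.choose_eq_zero_of_lt this]
        · simp [hj]
    simp only [key]
    rw [Finset.sum_ite_eq' ]
    split_ifs with hmem
    · rfl
    · rw [coeff_eq_zero_of_natDegree_lt (by simpa using hmem), mul_zero]

theorem exists_choose_expChar_pow_ne_zero (k : Type*) [Field k] (p : ℕ) [ExpChar k p] {m : ℕ}
    (hm : m ≠ 0) : ∃ v : ℕ, p ^ v ∣ m ∧ (m.choose (p ^ v) : k) ≠ 0 := by
  rcases ‹ExpChar k p› with _ | hp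
  · exact ⟨0, by simp, by simpa using hm⟩
  · obtain ⟨v, u, hu, rfl⟩ := Nat.exists_eq_pow_mul_and_not_dvd hm p hp.ne_one
    refine ⟨v, dvd_mul_right _ _, ?_⟩
    have : Fact p.Prime := ⟨hp⟩
    have h1 : ((1 + X : k[X]) ^ (p ^ v * u)).coeff (p ^ v) = (p ^ v * u).choose (p ^ v) :=
      coeff_one_add_X_pow k _ _
    have h2 : ((1 + X : k[X]) ^ (p ^ v * u)) = expand k (p ^ v) ((1 + X) ^ u) := by
      rw [pow_mul, add_pow_char_pow]
      simp
    rw [← h1, h2]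
    have h3 := coeff_expand_mul (R := k) (pow_pos hp.pos v) ((1 + X) ^ u) 1
    rw [one_mul] at h3
    rw [h3, coeff_one_add_X_pow, Nat.choose_one_right]
    rwa [Ne, CharP.cast_eq_zero_iff k p]

namespace IsIterative

variable {φ : A →ₐ[k] A[X]}

theorem injective (hφ : IsIterative φ) : Function.Injective φ := fun a b h => by
  rw [← hφ.coeff_zero a, h, hφ.coeff_zero]

theorem mem_iff (hφ : IsIterative φ) {a : A} :
    a ∈ fixedSubalgebra φ ↔ (φ a).natDegree = 0 := by
  rw [mem_fixedSubalgebra]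
  constructor
  · intro h
    rw [h, natDegree_C]
  · intro h
    rw [eq_C_of_natDegree_eq_zero h, hφ.coeff_zero]

theorem mem_of_dvd [IsDomain A] (hφ : IsIterative φ) {a b : A} (hb : b ∈ fixedSubalgebra φ)
    (hb0 : b ≠ 0) (hab : a ∣ b) : a ∈ fixedSubalgebra φ := by
  obtain ⟨c, rfl⟩ := hab
  rw [hφ.mem_iff] at hb ⊢
  rw [map_mul, natDegree_mul] at hb
  · omega
  · exact (map_ne_zero_iff _ hφ.injective).2 (left_ne_zero_of_mul hb0)
  · exact (map_ne_zero_iff _ hφ.injective).2 (right_ne_zero_of_mul hb0)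

theorem coeff_mem (hφ : IsIterative φ) {a : A} {m : ℕ} (h : (φ a).natDegree ≤ m) :
    (φ a).coeff m ∈ fixedSubalgebra φ := by
  rw [mem_fixedSubalgebra]
  ext j
  rw [hφ.coeff_coeff, coeff_C]
  split_ifs with hj
  · simp [hj]
  · rw [coeff_eq_zero_of_natDegree_lt (by omega), mul_zero]

theorem natDegree_coeff_sub [IsDomain A] (hφ : IsIterative φ) {a : A} {i : ℕ}
    (hi : i ≤ (φ a).natDegree) (hc : ((φ a).natDegree.choose i : k) ≠ 0) :
    (φ ((φ a).coeff ((φ a).natDegree - i))).natDegree = i := by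
  set m := (φ a).natDegree with hm
  by_cases hi0 : i = 0
  · subst hi0
    rw [Nat.sub_zero, ← hφ.mem_iff]
    exact hφ.coeff_mem le_rfl
  have ha : φ a ≠ 0 := by
    intro h
    rw [h, natDegree_zero] at hm
    omega
  refine natDegree_eq_of_le_of_coeff_ne_zero ?_ ?_
  · rw [natDegree_le_iff_coeff_eq_zero]
    intro j hj
    rw [hφ.coeff_coeff, coeff_eq_zero_of_natDegree_lt (by omega), mul_zero]
  · rw [hφ.coeff_coeff, Nat.sub_add_cancel hi, Nat.choose_symm hi]
    refine mul_ne_zero ?_ (by simpa [hm] using ha)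
    rw [← map_natCast (algebraMap k A)]
    exact (map_ne_zero_iff _ (algebraMap k A).injective).2 hc

/-- `n` is the least positive degree attained by the coaction. -/
structure _root_.IsMinDegree (φ : A →ₐ[k] A[X]) (n : ℕ) : Prop where
  pos : 0 < n
  le : ∀ a, (φ a).natDegree ≠ 0 → n ≤ (φ a).natDegree
  ex : ∃ a, (φ a).natDegree = n

theorem exists_isMinDegree (hφ : IsIterative φ) (h : ∃ a, φ a ≠ C a) : ∃ n, IsMinDegree φ n := by
  classical
  have h' : ∃ n, 0 < n ∧ ∃ a, (φ a).natDegree = n := by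
    obtain ⟨a, ha⟩ := h
    exact ⟨_, Nat.pos_of_ne_zero fun h0 => ha (hφ.mem_iff.2 h0), a, rfl⟩
  refine ⟨Nat.find h', (Nat.find_spec h').1, fun a ha => ?_, (Nat.find_spec h').2⟩
  exact Nat.find_min' h' ⟨Nat.pos_of_ne_zero ha, a, rfl⟩

theorem _root_.IsMinDegree.dvd [IsDomain A] {n : ℕ} (hn : IsMinDegree φ n) (hφ : IsIterative φ)
    (a : A) : n ∣ (φ a).natDegree := by
  obtain ⟨p, hp⟩ := ExpChar.exists k
  have hp1 : 0 < p := expChar_pos k p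
  have main : ∀ b, (φ b).natDegree ≠ 0 → ∃ v, p ^ v ∣ (φ b).natDegree ∧ n ≤ p ^ v := by
    intro b hb
    obtain ⟨v, hv, hv'⟩ := exists_choose_expChar_pow_ne_zero k p hb
    refine ⟨v, hv, ?_⟩
    have h := hφ.natDegree_coeff_sub (Nat.le_of_dvd (Nat.pos_of_ne_zero hb) hv) hv'
    have := hn.le ((φ b).coeff ((φ b).natDegree - p ^ v)) (by rw [h]; positivity)
    rwa [h] at this
  by_cases ha : (φ a).natDegree = 0
  · simp [ha]
  obtain ⟨x, hx⟩ := hn.ex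
  have hn0 := hn.pos
  obtain ⟨e, he, he'⟩ := main x (by omega)
  rw [hx] at he
  have hne : n = p ^ e := le_antisymm he' (Nat.le_of_dvd hn0 he)
  obtain ⟨v, hv, hv'⟩ := main a ha
  refine dvd_trans ?_ hv
  rw [hne] at hv' ⊢
  rcases Nat.lt_or_ge 1 p with h1 | h1
  · exact pow_dvd_pow _ ((Nat.pow_le_pow_iff_right h1).1 hv')
  · have : p = 1 := by omega
    simp [this]

theorem exists_pow_mul_mem_adjoin [IsDomain A] {n : ℕ} (hφ : IsIterative φ)
    (hn : IsMinDegree φ n) {x : A} (hx : (φ x).natDegree = n) (a : A) :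
    ∃ N : ℕ, ((φ x).coeff n) ^ N * a ∈ Algebra.adjoin (fixedSubalgebra φ) {x} := by
  set R := fixedSubalgebra φ with hR
  set c := (φ x).coeff n with hc
  have hcR : c ∈ R := hφ.coeff_mem hx.le
  have hRW : ∀ r ∈ R, r ∈ Algebra.adjoin R {x} := fun r hr =>
    Subalgebra.algebraMap_mem _ (⟨r, hr⟩ : R)
  have hxW : x ∈ Algebra.adjoin R {x} := Algebra.self_mem_adjoin_singleton R x
  have hn0 := hn.pos
  induction hm : (φ a).natDegree using Nat.strong_induction_on generalizing a with
  | _ m ih =>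
    by_cases hm0 : m = 0
    · exact ⟨0, by simpa using hRW a (hφ.mem_iff.2 (hm.trans hm0))⟩
    obtain ⟨q, hq⟩ := hn.dvd hφ a
    rw [hm] at hq
    have hamR : (φ a).coeff m ∈ R := hφ.coeff_mem hm.le
    have hb : (φ (c ^ q * a - (φ a).coeff m * x ^ q)).natDegree < m := by
      have e : φ (c ^ q * a - (φ a).coeff m * x ^ q)
          = C (c ^ q) * φ a - C ((φ a).coeff m) * (φ x) ^ q := by
        rw [map_sub, map_mul, map_mul, map_pow, map_pow, mem_fixedSubalgebra.1 hcR,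
          mem_fixedSubalgebra.1 hamR, C_pow]
      have hxq : ((φ x) ^ q).natDegree ≤ m := by
        rw [natDegree_pow, hx, hq, mul_comm]
      have hle : (φ (c ^ q * a - (φ a).coeff m * x ^ q)).natDegree ≤ m := by
        rw [e]
        refine (natDegree_sub_le _ _).trans (max_le ?_ ?_)
        · exact (natDegree_C_mul_le _ _).trans hm.le
        · exact (natDegree_C_mul_le _ _).trans hxq
      refine lt_of_le_of_ne hle fun heq => ?_
      have h0 : (φ (c ^ q * a - (φ a).coeff m * x ^ q)).coeff m = 0 := by
        rw [e, coeff_sub, coeff_C_mul, coeff_C_mul]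
        have : ((φ x) ^ q).coeff m = c ^ q := by
          rw [hq, mul_comm n q, coeff_pow_of_natDegree_le hx.le]
        rw [this]
        ring
      have hne : φ (c ^ q * a - (φ a).coeff m * x ^ q) ≠ 0 := fun h => by
        rw [h, natDegree_zero] at heq
        omega
      exact leadingCoeff_ne_zero.2 hne (by rw [leadingCoeff, heq, h0])
    obtain ⟨N, hN⟩ := ih _ hb _ rfl
    refine ⟨N + q, ?_⟩
    have : c ^ (N + q) * a = c ^ N * (c ^ q * a - (φ a).coeff m * x ^ q)
        + c ^ N * ((φ a).coeff m * x ^ q) := by ring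
    rw [this]
    exact add_mem hN (mul_mem (pow_mem (hRW c hcR) _)
      (mul_mem (hRW _ hamR) (pow_mem hxW _)))

theorem transcendental [IsDomain A] (hφ : IsIterative φ) {x : A} (hx : x ∉ fixedSubalgebra φ) :
    Transcendental (fixedSubalgebra φ) x := by
  rw [hφ.mem_iff] at hx
  rw [transcendental_iff]
  intro P hP
  have h1 : φ (aeval x P) = (P.map (C.comp (algebraMap (fixedSubalgebra φ) A))).eval (φ x) := by
    rw [aeval_def, ← AlgHom.coe_toRingHom, hom_eval₂, eval_map]
    congr 1
    ext1 r
    exact mem_fixedSubalgebra.1 r.2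
  have h2 : (P.map (C.comp (algebraMap (fixedSubalgebra φ) A))).eval (φ x)
      = (P.map (algebraMap (fixedSubalgebra φ) A)).comp (φ x) := by
    rw [comp, eval_map, eval₂_map]
  rw [hP, map_zero, h2] at h1
  have h3 := congrArg natDegree h1
  rw [natDegree_zero, natDegree_comp] at h3
  have h4 : (P.map (algebraMap (fixedSubalgebra φ) A)).natDegree = 0 := by
    rcases mul_eq_zero.1 h3.symm with h | h
    · exact h
    · exact absurd h hx
  have hinj : Function.Injective (algebraMap (fixedSubalgebra φ) A) := Subtype.val_injective
  rw [eq_C_of_natDegree_eq_zero h4, C_comp] at h1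
  apply (Polynomial.map_eq_zero_iff hinj).1
  rw [eq_C_of_natDegree_eq_zero h4, ← h1]

end IsIterative
end

section
open Polynomial TensorProduct

/-- A surjective endomorphism of a polynomial ring in two variables over a field is injective. -/
theorem MvPolynomial.fin_two_injective_of_surjective {L : Type*} [Field L]
    (g : MvPolynomial (Fin 2) L →ₐ[L] MvPolynomial (Fin 2) L) (hg : Function.Surjective g) :
    Function.Injective g := by
  have hge : g = MvPolynomial.aeval fun i => g (MvPolynomial.X i) := MvPolynomial.aeval_unique g
  have htop : Algebra.adjoin L (Set.range fun i => g (MvPolynomial.X i)) = ⊤ := by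
    rw [Algebra.adjoin_range_eq_range_aeval, ← hge, AlgHom.range_eq_top]
    exact hg
  have : Algebra.IsAlgebraic (Algebra.adjoin L (Set.range fun i => g (MvPolynomial.X i)))
      (MvPolynomial (Fin 2) L) := by
    rw [htop]
    exact ⟨fun a => isAlgebraic_algebraMap (⟨a, trivial⟩ : (⊤ : Subalgebra L _))⟩
  have h := Algebra.IsAlgebraic.isTranscendenceBasis_of_lift_le_trdeg_of_finite L
    (fun i : Fin 2 => g (MvPolynomial.X i)) (by simp)
  have h2 : Function.Injective (MvPolynomial.aeval (R := L) fun i => g (MvPolynomial.X i)) := h.1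
  rwa [← hge] at h2

section Form

variable {L : Type*} [Field L] [Algebra k L]

theorem injective_of_surjective_of_form (e : L ⊗[k] A ≃ₐ[L] MvPolynomial (Fin 2) L)
    (f : MvPolynomial (Fin 2) k →ₐ[k] A) (hf : Function.Surjective f) : Function.Injective f := by
  have h := MvPolynomial.fin_two_injective_of_surjective
    ((e.toAlgHom.comp (Algebra.TensorProduct.map (AlgHom.id L L) f)).comp
      (MvPolynomial.algebraTensorAlgEquiv k L).symm.toAlgHom) (by
      refine (e.surjective.comp ?_).comp (AlgEquiv.surjective _)
      exact Algebra.TensorProduct.map_surjective _ _ Function.surjective_id hf)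
  rw [injective_iff_map_eq_zero]
  intro a ha
  have h1 : MvPolynomial.map (algebraMap k L) a = 0 := by
    refine (injective_iff_map_eq_zero _).1 h _ ?_
    change e (Algebra.TensorProduct.map (AlgHom.id L L) f
      ((MvPolynomial.algebraTensorAlgEquiv k L).symm (MvPolynomial.map (algebraMap k L) a))) = 0
    rw [MvPolynomial.algebraTensorAlgEquiv_symm_map, Algebra.TensorProduct.map_tmul, ha,
      tmul_zero, map_zero]
  exact MvPolynomial.map_injective _ (algebraMap k L).injective (h1.trans (map_zero _).symm)

theorem adjoin_singleton_ne_top_of_form (e : L ⊗[k] A ≃ₐ[L] MvPolynomial (Fin 2) L) (x : A) :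
    Algebra.adjoin k {x} ≠ ⊤ := by
  intro h
  have hs : Function.Surjective (MvPolynomial.aeval (R := k) ![x, 0]) := by
    rw [← AlgHom.range_eq_top, ← Algebra.adjoin_range_eq_range_aeval, eq_top_iff, ← h]
    exact Algebra.adjoin_mono (Set.singleton_subset_iff.2 ⟨0, rfl⟩)
  have h1 := @injective_of_surjective_of_form _ _ _ _ _ _ _ _ e _ hs
    (MvPolynomial.X 1) 0 (by simp)
  exact MvPolynomial.X_ne_zero _ h1

theorem trdeg_le_two_of_form [IsDomain A] (e : L ⊗[k] A ≃ₐ[L] MvPolynomial (Fin 2) L) :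
    Algebra.trdeg k A ≤ 2 := by
  obtain ⟨ι, x, hx⟩ := exists_isTranscendenceBasis' k A
  rw [← hx.cardinalMk_eq_trdeg]
  have hinj : Function.Injective (MvPolynomial.aeval (R := k) x) := hx.1
  let g : MvPolynomial ι L →ₐ[L] MvPolynomial (Fin 2) L :=
    (e.toAlgHom.comp (Algebra.TensorProduct.map (AlgHom.id L L) (MvPolynomial.aeval x))).comp
      (MvPolynomial.algebraTensorAlgEquiv k L).symm.toAlgHom
  have hg : Function.Injective g := by
    refine (e.injective.comp ?_).comp (AlgEquiv.injective _)
    exact Module.Flat.lTensor_preserves_injective_linearMap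
      (M := L) (MvPolynomial.aeval (R := k) x).toLinearMap hinj
  have h := lift_trdeg_le_of_injective g hg
  simpa using h

end Form

theorem IsAlgClosed.mem_range_algebraMap_of_aeval_eq_zero {K Q : Type*} [Field K] [IsAlgClosed K]
    [CommRing Q] [IsDomain Q] [Algebra K Q] {y : Q} {G : K[X]} (hG : G ≠ 0) (h : aeval y G = 0) :
    y ∈ (algebraMap K Q).range := by
  have hint : IsIntegral K y := IsAlgebraic.isIntegral ⟨G, hG, h⟩
  exact minpoly.mem_range_of_degree_eq_one K y
    (IsAlgClosed.degree_eq_one_of_irreducible K (minpoly.irreducible hint))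

namespace IsIterative

variable {φ : A →ₐ[k] A[X]}

theorem isPrincipalIdealRing_of_eq_adjoin {t : A} (ht : fixedSubalgebra φ = Algebra.adjoin k {t}) :
    IsPrincipalIdealRing (fixedSubalgebra φ) := by
  rw [ht]
  have hs : Function.Surjective
      (aeval (R := k) (⟨t, Algebra.self_mem_adjoin_singleton k t⟩ : Algebra.adjoin k {t})) := by
    rintro ⟨r, hr⟩
    have hr' := hr
    rw [Algebra.adjoin_singleton_eq_range_aeval] at hr'
    obtain ⟨P, hP⟩ := hr'
    refine ⟨P, Subtype.ext ?_⟩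
    refine Eq.trans ?_ hP
    exact (aeval_algHom_apply (Algebra.adjoin k {t}).val _ P).symm
  exact IsPrincipalIdealRing.of_surjective (aeval (R := k)
    (⟨t, Algebra.self_mem_adjoin_singleton k t⟩ : Algebra.adjoin k {t})).toRingHom hs

theorem exists_dvd_coeff [IsPrincipalIdealRing (fixedSubalgebra φ)] {n : ℕ} (hφ : IsIterative φ)
    (hn : IsMinDegree φ n) : ∃ x, (φ x).natDegree = n ∧
      ∀ a, (φ a).natDegree ≤ n → ∃ r ∈ fixedSubalgebra φ, (φ a).coeff n = (φ x).coeff n * r := by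
  let I : Ideal (fixedSubalgebra φ) :=
    { carrier := {r | ∃ a, (φ a).natDegree ≤ n ∧ (φ a).coeff n = r}
      add_mem' := by
        rintro r s ⟨a, ha, ha'⟩ ⟨b, hb, hb'⟩
        refine ⟨a + b, ?_, ?_⟩
        · rw [map_add]
          exact (natDegree_add_le _ _).trans (max_le ha hb)
        · rw [map_add, coeff_add, ha', hb', Subalgebra.coe_add]
      zero_mem' := ⟨0, by simp, by simp⟩
      smul_mem' := by
        rintro r s ⟨a, ha, ha'⟩
        have hr := mem_fixedSubalgebra.1 r.2
        refine ⟨r * a, ?_, ?_⟩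
        · rw [map_mul, hr]
          exact (natDegree_C_mul_le _ _).trans ha
        · rw [map_mul, hr, coeff_C_mul, ha', smul_eq_mul, Subalgebra.coe_mul] }
  obtain ⟨g, hg⟩ := IsPrincipalIdealRing.principal I
  have hgI : g ∈ I := hg ▸ Submodule.mem_span_singleton_self g
  obtain ⟨x, hx, hxg⟩ := hgI
  have key : ∀ a, (φ a).natDegree ≤ n →
      ∃ r ∈ fixedSubalgebra φ, (φ a).coeff n = (φ x).coeff n * r := by
    intro a ha
    have hmem : (⟨_, hφ.coeff_mem ha⟩ : fixedSubalgebra φ) ∈ I := ⟨a, ha, rfl⟩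
    rw [hg] at hmem
    obtain ⟨r, hr⟩ := Ideal.mem_span_singleton'.1 hmem
    refine ⟨r, r.2, ?_⟩
    rw [hxg, mul_comm]
    exact (congrArg Subtype.val hr).symm
  refine ⟨x, le_antisymm hx (Nat.le_of_not_lt fun hlt => ?_), key⟩
  obtain ⟨a, ha⟩ := hn.ex
  obtain ⟨r, -, hr⟩ := key a ha.le
  rw [coeff_eq_zero_of_natDegree_lt hlt, zero_mul, ← ha, coeff_natDegree,
    leadingCoeff_eq_zero] at hr
  rw [hr, natDegree_zero] at ha
  exact hn.pos.ne ha

theorem mem_adjoin_of_natDegree_le {n : ℕ} (hφ : IsIterative φ) (hn : IsMinDegree φ n) {x : A}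
    (hx : (φ x).natDegree = n)
    (hc : ∀ a, (φ a).natDegree ≤ n →
      ∃ r ∈ fixedSubalgebra φ, (φ a).coeff n = (φ x).coeff n * r)
    {a : A} (ha : (φ a).natDegree ≤ n) : a ∈ Algebra.adjoin (fixedSubalgebra φ) {x} := by
  obtain ⟨r, hr, hr'⟩ := hc a ha
  have h1 : φ (a - r * x) = φ a - C r * φ x := by
    rw [map_sub, map_mul, mem_fixedSubalgebra.1 hr]
  have h2 : (φ (a - r * x)).natDegree ≤ n - 1 := by
    refine natDegree_le_pred ?_ ?_
    · rw [h1]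
      exact (natDegree_sub_le _ _).trans (max_le ha ((natDegree_C_mul_le _ _).trans hx.le))
    · rw [h1, coeff_sub, coeff_C_mul, hr']
      ring
  have h3 : a - r * x ∈ fixedSubalgebra φ := by
    rw [hφ.mem_iff]
    by_contra h
    have := hn.le _ h
    have := hn.pos
    omega
  have h4 : a = (a - r * x) + r * x := by ring
  rw [h4]
  exact add_mem (Subalgebra.algebraMap_mem _ (⟨_, h3⟩ : fixedSubalgebra φ))
    (mul_mem (Subalgebra.algebraMap_mem _ (⟨r, hr⟩ : fixedSubalgebra φ))
      (Algebra.self_mem_adjoin_singleton _ x))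

theorem mem_adjoin_of_prime_mul_mem [IsDomain A] [IsAlgClosed k] {n : ℕ} (hφ : IsIterative φ)
    (hn : IsMinDegree φ n) {t : A} (ht : fixedSubalgebra φ = Algebra.adjoin k {t}) {x : A}
    (hx : (φ x).natDegree = n)
    (hc : ∀ a, (φ a).natDegree ≤ n →
      ∃ r ∈ fixedSubalgebra φ, (φ a).coeff n = (φ x).coeff n * r)
    {q : A} (hq : Prime q) (hqc : q ∣ (φ x).coeff n) {a : A}
    (ha : q * a ∈ Algebra.adjoin (fixedSubalgebra φ) {x}) :
    a ∈ Algebra.adjoin (fixedSubalgebra φ) {x} := by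
  have hc0 : (φ x).coeff n ≠ 0 := by
    rw [← hx, coeff_natDegree, Ne, leadingCoeff_eq_zero]
    intro h
    rw [h, natDegree_zero] at hx
    exact hn.pos.ne hx
  have hqR : q ∈ fixedSubalgebra φ := hφ.mem_of_dvd (hφ.coeff_mem hx.le) hc0 hqc
  have hq' := mem_fixedSubalgebra.1 hqR
  have : (Ideal.span {q}).IsPrime := (Ideal.span_singleton_prime hq.ne_zero).2 hq
  let π : A →ₐ[k] A ⧸ Ideal.span {q} := Ideal.Quotient.mkₐ k _
  have hπ : ∀ b, π b = 0 ↔ q ∣ b := fun b => by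
    rw [← Ideal.mem_span_singleton]
    exact Ideal.Quotient.eq_zero_iff_mem
  have hxbar : π x ∉ (algebraMap k (A ⧸ Ideal.span {q})).range := by
    rintro ⟨μ, hμ⟩
    have h0 : π (x - algebraMap k A μ) = 0 := by
      rw [map_sub, AlgHom.commutes, hμ, sub_self]
    obtain ⟨y, hy⟩ := (hπ _).1 h0
    have h1 : φ x - C (algebraMap k A μ) = C q * φ y := by
      rw [← hq', ← map_mul, ← hy, map_sub, AlgHom.commutes]
      rfl
    have h2 : (φ y).natDegree = n := by
      rw [← hx, ← natDegree_C_mul (p := φ y) hq.ne_zero, ← h1, natDegree_sub_C]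
    have h3 := congrArg (coeff · n) h1
    simp only [coeff_sub, coeff_C_mul, coeff_C_of_ne_zero hn.pos.ne', sub_zero] at h3
    obtain ⟨r, -, hr⟩ := hc y h2.le
    rw [hr, mul_left_comm] at h3
    exact hq.not_isUnit (IsUnit.of_mul_eq_one r (mul_left_cancel₀ hc0 (by rw [← h3, mul_one])))
  have hRbar : ∀ r ∈ fixedSubalgebra φ, π r ∈ (algebraMap k (A ⧸ Ideal.span {q})).range := by
    rw [ht, Algebra.adjoin_singleton_eq_range_aeval] at hqR ⊢
    obtain ⟨Q, hQ⟩ := hqR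
    have hQ0 : Q ≠ 0 := by
      rintro rfl
      exact hq.ne_zero (by rw [← hQ]; exact map_zero _)
    have htbar : π t ∈ (algebraMap k (A ⧸ Ideal.span {q})).range := by
      refine IsAlgClosed.mem_range_algebraMap_of_aeval_eq_zero hQ0 ?_
      rw [aeval_algHom_apply, hπ]
      exact dvd_of_eq hQ.symm
    obtain ⟨l, hl⟩ := htbar
    rintro _ ⟨P, rfl⟩
    refine ⟨P.eval l, ?_⟩
    change _ = π (aeval t P)
    rw [← aeval_algHom_apply, ← hl, aeval_algebraMap_apply, ← coe_aeval_eq_eval]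
  rw [Algebra.adjoin_singleton_eq_range_aeval] at ha ⊢
  obtain ⟨F, hF⟩ := ha
  change aeval x F = q * a at hF
  let ρ : fixedSubalgebra φ →+* A ⧸ Ideal.span {q} :=
    π.toRingHom.comp (algebraMap (fixedSubalgebra φ) A)
  obtain ⟨G, hG⟩ : F.map ρ ∈ lifts (algebraMap k (A ⧸ Ideal.span {q})) := by
    rw [lifts_iff_coeff_lifts]
    intro i
    rw [coeff_map]
    exact hRbar _ (F.coeff i).2
  have hG' : G.map (algebraMap k (A ⧸ Ideal.span {q})) = F.map ρ := hG
  have hGx : aeval (π x) G = 0 := by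
    rw [aeval_def, ← eval_map, hG', eval_map]
    have : eval₂ ρ (π x) F = π (aeval x F) := (hom_eval₂ F _ π.toRingHom x).symm
    rw [this, hF, hπ]
    exact dvd_mul_right _ _
  have hG0 : G = 0 := by
    by_contra h
    exact hxbar (IsAlgClosed.mem_range_algebraMap_of_aeval_eq_zero h hGx)
  rw [hG0, Polynomial.map_zero] at hG'
  have hdvd : C (⟨q, mem_fixedSubalgebra.2 hq'⟩ : fixedSubalgebra φ) ∣ F := by
    rw [C_dvd_iff_dvd_coeff]
    intro i
    have h0 : π (F.coeff i) = 0 := by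
      have := congrArg (coeff · i) hG'
      simp only [coeff_map] at this
      exact this.symm
    obtain ⟨s, hs⟩ := (hπ _).1 h0
    by_cases hs0 : (F.coeff i : A) = 0
    · have : F.coeff i = 0 := Subtype.ext hs0
      rw [this]
      exact dvd_zero _
    · refine ⟨⟨s, hφ.mem_of_dvd (F.coeff i).2 hs0 (hs ▸ dvd_mul_left _ _)⟩, Subtype.ext hs⟩
  obtain ⟨F', rfl⟩ := hdvd
  refine ⟨F', mul_left_cancel₀ hq.ne_zero ?_⟩
  rw [← hF, map_mul, aeval_C]
  rfl

theorem adjoin_eq_top [IsDomain A] [UniqueFactorizationMonoid A] [IsAlgClosed k] {n : ℕ}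
    (hφ : IsIterative φ) (hn : IsMinDegree φ n) {t : A}
    (ht : fixedSubalgebra φ = Algebra.adjoin k {t}) {x : A}
    (hx : (φ x).natDegree = n)
    (hc : ∀ a, (φ a).natDegree ≤ n →
      ∃ r ∈ fixedSubalgebra φ, (φ a).coeff n = (φ x).coeff n * r) :
    Algebra.adjoin (fixedSubalgebra φ) {x} = ⊤ := by
  have hc0 : (φ x).coeff n ≠ 0 := by
    rw [← hx, coeff_natDegree, Ne, leadingCoeff_eq_zero]
    intro h
    rw [h, natDegree_zero] at hx
    exact hn.pos.ne hx
  have main : ∀ d : A, d ∣ (φ x).coeff n → ∀ a,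
      d * a ∈ Algebra.adjoin (fixedSubalgebra φ) {x} →
      a ∈ Algebra.adjoin (fixedSubalgebra φ) {x} := by
    intro d
    induction d using UniqueFactorizationMonoid.induction_on_prime with
    | h₁ => exact fun h => absurd (zero_dvd_iff.1 h) hc0
    | h₂ u hu =>
      intro _ a ha
      obtain ⟨v, hv⟩ := hu.exists_left_inv
      have hvR : v ∈ fixedSubalgebra φ :=
        hφ.mem_of_dvd (one_mem _) one_ne_zero (hv ▸ dvd_mul_right v u)
      have : a = v * (u * a) := by rw [← mul_assoc, hv, one_mul]
      rw [this]
      exact mul_mem (Subalgebra.algebraMap_mem _ (⟨v, hvR⟩ : fixedSubalgebra φ)) ha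
    | h₃ d p hd hp ih =>
      intro hdvd a ha
      refine ih (dvd_of_mul_left_dvd hdvd) a ?_
      rw [mul_assoc] at ha
      exact hφ.mem_adjoin_of_prime_mul_mem hn ht hx hc hp (dvd_of_mul_right_dvd hdvd) ha
  rw [eq_top_iff]
  rintro a -
  obtain ⟨N, hN⟩ := hφ.exists_pow_mul_mem_adjoin hn hx a
  induction N with
  | zero => simpa using hN
  | succ N ih =>
    rw [pow_succ', mul_assoc] at hN
    exact ih (main _ dvd_rfl _ hN)

end IsIterative

namespace IsIterative

variable {φ : A →ₐ[k] A[X]} {L : Type*} [Field L] [Algebra k L]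

theorem trdeg_fixedSubalgebra_le_one [IsDomain A] (hφ : IsIterative φ) {n : ℕ}
    (hn : IsMinDegree φ n) (hA : Algebra.trdeg k A ≤ 2) :
    Algebra.trdeg k (fixedSubalgebra φ) ≤ 1 := by
  obtain ⟨x, hx⟩ := hn.ex
  have hxR : x ∉ fixedSubalgebra φ := fun h => hn.pos.ne (((hφ.mem_iff).1 h).symm.trans hx)
  have : Algebra.Transcendental (fixedSubalgebra φ) A := ⟨x, hφ.transcendental hxR⟩
  have h1 : 1 ≤ Algebra.trdeg (fixedSubalgebra φ) A :=
    Cardinal.one_le_iff_pos.2 (trdeg_pos _ _)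
  rw [← trdeg_add_eq k (fixedSubalgebra φ)] at hA
  have h2 := (add_le_add_right h1 _).trans hA
  rw [← one_add_one_eq_two] at h2
  exact Cardinal.add_one_le_add_one_iff.1 h2

theorem exists_dvd_aeval [IsDomain A] (hR : Algebra.trdeg k (fixedSubalgebra φ) ≤ 1)
    {t r : A} (ht : t ∈ fixedSubalgebra φ) (hr : r ∈ fixedSubalgebra φ) (ht0 : t ≠ 0) :
    ∃ Q : k[X], Q ≠ 0 ∧ t ∣ aeval r Q := by
  by_cases hr' : IsAlgebraic k (⟨r, hr⟩ : fixedSubalgebra φ)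
  · obtain ⟨Q, hQ, h0⟩ := hr'
    refine ⟨Q, hQ, ?_⟩
    have : aeval r Q = 0 := by
      have h := aeval_algHom_apply (fixedSubalgebra φ).val (⟨r, hr⟩ : fixedSubalgebra φ) Q
      rw [h0, map_zero] at h
      exact h
    rw [this]
    exact dvd_zero _
  · have hind : AlgebraicIndependent k fun _ : Unit => (⟨r, hr⟩ : fixedSubalgebra φ) :=
      algebraicIndependent_unique_type_iff.2 hr'
    have hbasis := hind.isTranscendenceBasis_of_lift_trdeg_le_of_finite (by simpa using hR)
    have halg := hbasis.isAlgebraic.1 (⟨t, ht⟩ : fixedSubalgebra φ)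
    obtain ⟨⟨c, hc⟩, hc0, hdvd⟩ := halg.exists_nonzero_dvd
      (mem_nonZeroDivisors_of_ne_zero fun h => ht0 (congrArg Subtype.val h))
    have hc' := hc
    rw [Set.range_const, Algebra.adjoin_singleton_eq_range_aeval] at hc'
    obtain ⟨Q, hQ⟩ := hc'
    refine ⟨Q, ?_, ?_⟩
    · rintro rfl
      exact hc0 (Subtype.ext (hQ.symm.trans (map_zero _)))
    · have h := aeval_algHom_apply (fixedSubalgebra φ).val (⟨r, hr⟩ : fixedSubalgebra φ) Q
      have h' : aeval r Q = (c : A) := h.trans (congrArg Subtype.val hQ)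
      rw [h']
      exact map_dvd (fixedSubalgebra φ).val hdvd

theorem fixedSubalgebra_ne_bot [IsDomain A] (hφ : IsIterative φ) {n : ℕ}
    (hn : IsMinDegree φ n) (hA : ∀ x : A, Algebra.adjoin k {x} ≠ ⊤) :
    fixedSubalgebra φ ≠ ⊥ := by
  intro hbot
  obtain ⟨x, hx⟩ := hn.ex
  have hc0 : (φ x).coeff n ≠ 0 := by
    rw [← hx, coeff_natDegree, Ne, leadingCoeff_eq_zero]
    intro h
    rw [h, natDegree_zero] at hx
    exact hn.pos.ne hx
  have hcR : (φ x).coeff n ∈ fixedSubalgebra φ := hφ.coeff_mem hx.le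
  rw [hbot] at hcR
  obtain ⟨c, hc⟩ := Algebra.mem_bot.1 hcR
  have hc0' : c ≠ 0 := by
    rintro rfl
    exact hc0 (by rw [← hc, map_zero])
  have hle : ∀ b ∈ Algebra.adjoin (fixedSubalgebra φ) {x}, b ∈ Algebra.adjoin k {x} := by
    intro b hb
    induction hb using Algebra.adjoin_induction with
    | mem y hy => exact Algebra.subset_adjoin hy
    | algebraMap r =>
      obtain ⟨s, hs⟩ := Algebra.mem_bot.1 (hbot.le r.2)
      have : algebraMap (fixedSubalgebra φ) A r = algebraMap k A s := hs.symm
      rw [this]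
      exact Subalgebra.algebraMap_mem _ _
    | add _ _ _ _ h1 h2 => exact add_mem h1 h2
    | mul _ _ _ _ h1 h2 => exact mul_mem h1 h2
  refine hA x (eq_top_iff.2 fun a _ => ?_)
  obtain ⟨N, hN⟩ := hφ.exists_pow_mul_mem_adjoin hn hx a
  have h1 := Subalgebra.smul_mem _ (hle _ hN) ((c ^ N)⁻¹)
  rw [← hc, ← map_pow, ← Algebra.smul_def, smul_smul, inv_mul_cancel₀ (pow_ne_zero _ hc0'),
    one_smul] at h1
  exact h1

/-- The invariant ring of a nontrivial action on a factorial form of the plane with a rational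
point is generated by one element. -/
theorem exists_fixedSubalgebra_eq_adjoin [IsDomain A] [UniqueFactorizationMonoid A]
    (hφ : IsIterative φ) {n : ℕ} (hn : IsMinDegree φ n)
    (e : L ⊗[k] A ≃ₐ[L] MvPolynomial (Fin 2) L) (ε : A →ₐ[k] k) :
    ∃ t, fixedSubalgebra φ = Algebra.adjoin k {t} := by
  have htr := hφ.trdeg_fixedSubalgebra_le_one hn (trdeg_le_two_of_form e)
  obtain ⟨r, hr, hrbot⟩ : ∃ r ∈ fixedSubalgebra φ, r ∉ (⊥ : Subalgebra k A) := by
    by_contra! h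
    exact hφ.fixedSubalgebra_ne_bot hn (adjoin_singleton_ne_top_of_form e) (eq_bot_iff.2 h)
  have hr0 : r - algebraMap k A (ε r) ≠ 0 := fun h =>
    hrbot (Algebra.mem_bot.2 ⟨_, (sub_eq_zero.1 h).symm⟩)
  have hrR : r - algebraMap k A (ε r) ∈ fixedSubalgebra φ :=
    sub_mem hr (Subalgebra.algebraMap_mem _ _)
  have hε : ∀ c, ε (algebraMap k A c) = c := fun c => ε.commutes c
  obtain ⟨t, htp, htdvd, htε⟩ : ∃ t, Prime t ∧ t ∣ r - algebraMap k A (ε r) ∧ ε t = 0 := by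
    obtain ⟨f, hf, hassoc⟩ := UniqueFactorizationMonoid.exists_prime_factors _ hr0
    obtain ⟨u, hu⟩ := hassoc
    have h0 : ε f.prod = 0 := by
      have h1 : ε (f.prod * u) = 0 := by rw [hu, map_sub, hε, sub_self]
      rw [map_mul] at h1
      exact (mul_eq_zero.1 h1).resolve_right (u.isUnit.map ε).ne_zero
    rw [map_multiset_prod, Multiset.prod_eq_zero_iff] at h0
    obtain ⟨t, ht, ht0⟩ := Multiset.mem_map.1 h0
    exact ⟨t, hf t ht, (Multiset.dvd_prod ht).trans (hu ▸ dvd_mul_right _ _), ht0⟩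
  have htR : t ∈ fixedSubalgebra φ := hφ.mem_of_dvd hrR hr0 htdvd
  have hdvd : ∀ s ∈ fixedSubalgebra φ, ε s = 0 → t ∣ s := by
    intro s hs hεs
    obtain ⟨Q, hQ, hQd⟩ := exists_dvd_aeval htr htR hs htp.ne_zero
    obtain ⟨Q', hQQ', hQ'⟩ := exists_eq_pow_rootMultiplicity_mul_and_not_dvd Q hQ 0
    rw [C_0, sub_zero] at hQQ' hQ'
    rw [hQQ', map_mul, map_pow, aeval_X] at hQd
    rcases htp.dvd_or_dvd hQd with h | h
    · exact htp.dvd_of_dvd_pow h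
    · exfalso
      obtain ⟨w, hw⟩ := h
      have h1 := congrArg ε hw
      rw [map_mul, htε, zero_mul, ← aeval_algHom_apply, hεs, coe_aeval_eq_eval,
        ← coeff_zero_eq_eval_zero] at h1
      exact hQ' (X_dvd_iff.2 h1)
  let ι : A →ₐ[k] MvPolynomial (Fin 2) L :=
    (e.toAlgHom.restrictScalars k).comp Algebra.TensorProduct.includeRight
  have hι : Function.Injective ι :=
    e.injective.comp (Algebra.TensorProduct.includeRight_injective (algebraMap k L).injective)
  have htdeg : (ι t).totalDegree ≠ 0 := by
    intro h
    rw [MvPolynomial.totalDegree_eq_zero_iff_eq_C] at h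
    set l := MvPolynomial.coeff 0 (ι t) with hl
    have h1 : (1 : L) ⊗ₜ[k] t = l ⊗ₜ[k] (1 : A) := by
      apply e.injective
      refine Eq.trans h ?_
      exact (e.commutes l).symm
    let T : L ⊗[k] A →ₐ[L] L :=
      Algebra.TensorProduct.lift (AlgHom.id L L) ((Algebra.ofId k L).comp ε)
        (fun _ _ => mul_comm _ _)
    have hT : ∀ l a, T (l ⊗ₜ a) = l * algebraMap k L (ε a) :=
      fun l a => Algebra.TensorProduct.lift_tmul ..
    have h2 : T (1 ⊗ₜ t) = T (l ⊗ₜ 1) := congrArg T h1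
    have hl0 : l = 0 := by
      rw [hT, hT, htε, map_zero, mul_zero, map_one, map_one, mul_one] at h2
      exact h2.symm
    rw [hl0, MvPolynomial.C_0] at h
    exact htp.ne_zero (hι (h.trans (map_zero ι).symm))
  refine ⟨t, le_antisymm ?_ (Algebra.adjoin_le (Set.singleton_subset_iff.2 htR))⟩
  intro s hs
  induction hd : (ι s).totalDegree using Nat.strong_induction_on generalizing s with
  | _ d ih =>
    have hs' : s - algebraMap k A (ε s) ∈ fixedSubalgebra φ :=
      sub_mem hs (Subalgebra.algebraMap_mem _ _)
    obtain ⟨w, hw⟩ := hdvd _ hs' (by rw [map_sub, hε, sub_self])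
    have hsw : s = algebraMap k A (ε s) + t * w := by rw [← hw]; ring
    rw [hsw]
    refine add_mem (Subalgebra.algebraMap_mem _ _)
      (mul_mem (Algebra.self_mem_adjoin_singleton k t) ?_)
    by_cases hw0 : w = 0
    · rw [hw0]
      exact zero_mem _
    have hwR : w ∈ fixedSubalgebra φ :=
      hφ.mem_of_dvd hs' (hw ▸ mul_ne_zero htp.ne_zero hw0) (hw ▸ dvd_mul_left _ _)
    refine ih _ ?_ hwR rfl
    have h1 : (ι t * ι w).totalDegree = (ι t).totalDegree + (ι w).totalDegree :=
      MvPolynomial.totalDegree_mul_of_isDomain ((map_ne_zero_iff _ hι).2 htp.ne_zero)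
        ((map_ne_zero_iff _ hι).2 hw0)
    have h2 : (ι t * ι w).totalDegree ≤ d := by
      rw [← map_mul, ← hw, map_sub]
      refine (MvPolynomial.totalDegree_sub _ _).trans (max_le hd.le ?_)
      rw [AlgHom.commutes, IsScalarTower.algebraMap_apply k L, MvPolynomial.algebraMap_eq,
        MvPolynomial.totalDegree_C]
      exact Nat.zero_le _
    omega

end IsIterative
end

section
open Polynomial TensorProduct

section BaseChange

variable (K : Type*) [Field K] [Algebra k K]

/-- The extension of scalars of a coaction. -/
noncomputable def coactionBaseChange (φ : A →ₐ[k] A[X]) : K ⊗[k] A →ₐ[K] (K ⊗[k] A)[X] :=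
  Algebra.TensorProduct.lift (Algebra.ofId K (K ⊗[k] A)[X])
    ((mapAlgHom (Algebra.TensorProduct.includeRight : A →ₐ[k] K ⊗[k] A)).comp φ)
    (fun _ _ => Commute.all _ _)

theorem coeff_coactionBaseChange_tmul (φ : A →ₐ[k] A[X]) (l : K) (a : A) (i : ℕ) :
    (coactionBaseChange K φ (l ⊗ₜ a)).coeff i = l ⊗ₜ (φ a).coeff i := by
  have h : coactionBaseChange K φ (l ⊗ₜ a) = C (algebraMap K (K ⊗[k] A) l) *
      (φ a).map (Algebra.TensorProduct.includeRight : A →ₐ[k] K ⊗[k] A).toRingHom :=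
    Algebra.TensorProduct.lift_tmul ..
  rw [h, coeff_C_mul, coeff_map]
  simp [Algebra.TensorProduct.algebraMap_apply, Algebra.TensorProduct.tmul_mul_tmul]

theorem IsIterative.baseChange {φ : A →ₐ[k] A[X]} (hφ : IsIterative φ) :
    IsIterative (coactionBaseChange K φ) where
  coeff_zero b := by
    induction b using TensorProduct.induction_on with
    | zero => rw [map_zero, Polynomial.coeff_zero]
    | tmul l a => rw [coeff_coactionBaseChange_tmul, hφ.coeff_zero]
    | add b c hb hc => rw [map_add, coeff_add, hb, hc]
  coeff_coeff b i j := by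
    induction b using TensorProduct.induction_on with
    | zero => simp
    | tmul l a =>
      rw [coeff_coactionBaseChange_tmul, coeff_coactionBaseChange_tmul,
        coeff_coactionBaseChange_tmul, hφ.coeff_coeff, ← nsmul_eq_mul, ← nsmul_eq_mul,
        TensorProduct.tmul_smul]
    | add b c hb hc => rw [map_add, coeff_add, map_add, coeff_add, hb, hc, coeff_add, mul_add]

theorem coeff_coactionBaseChange_sum (φ : A →ₐ[k] A[X]) {ι : Type*} (f : ι → K) (c : ι →₀ A)
    (j : ℕ) : (coactionBaseChange K φ (c.sum fun i a => f i ⊗ₜ a)).coeff j =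
      c.sum fun i a => f i ⊗ₜ (φ a).coeff j := by
  rw [Finsupp.sum, map_sum, finsetSum_coeff]
  exact Finset.sum_congr rfl fun i _ => coeff_coactionBaseChange_tmul K φ _ _ _

theorem exists_natDegree_le_natDegree_coactionBaseChange (φ : A →ₐ[k] A[X]) (b : K ⊗[k] A) :
    ∃ c : Module.Basis.ofVectorSpaceIndex k K →₀ A,
      (c.sum fun i a => Module.Basis.ofVectorSpace k K i ⊗ₜ a) = b ∧
        ∀ i, (φ (c i)).natDegree ≤ (coactionBaseChange K φ b).natDegree := by
  obtain ⟨c, hc⟩ := TensorProduct.eq_repr_basis_left (Module.Basis.ofVectorSpace k K) b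
  refine ⟨c, hc, fun i => natDegree_le_iff_coeff_eq_zero.2 fun j hj => ?_⟩
  have h := coeff_eq_zero_of_natDegree_lt hj
  rw [← hc, coeff_coactionBaseChange_sum] at h
  let D : A →ₗ[k] A := ((lcoeff A j).restrictScalars k).comp φ.toLinearMap
  have h0 := TensorProduct.sum_tmul_basis_left_eq_zero (Module.Basis.ofVectorSpace k K)
    (c.mapRange D (map_zero D)) (by
      rw [Finsupp.sum_mapRange_index fun i => TensorProduct.tmul_zero _ _]
      exact h)
  exact DFunLike.congr_fun h0 i

variable {K}

theorem mem_baseChange_of_natDegree_le {φ : A →ₐ[k] A[X]} {W : Subalgebra k A} {d : ℕ}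
    (hW : ∀ a, (φ a).natDegree ≤ d → a ∈ W) {b : K ⊗[k] A}
    (hb : (coactionBaseChange K φ b).natDegree ≤ d) : b ∈ W.baseChange K := by
  obtain ⟨c, hc, hdeg⟩ := exists_natDegree_le_natDegree_coactionBaseChange K φ b
  rw [← hc]
  exact sum_mem fun i _ => Subalgebra.tmul_mem_baseChange (hW _ ((hdeg i).trans hb)) _

variable (K) in
theorem IsMinDegree.baseChange {φ : A →ₐ[k] A[X]} {n : ℕ} (hn : IsMinDegree φ n) :
    IsMinDegree (coactionBaseChange K φ) n where
  pos := hn.pos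
  le b hb := by
    by_contra! hlt
    obtain ⟨c, hc, hdeg⟩ := exists_natDegree_le_natDegree_coactionBaseChange K φ b
    refine hb (Nat.le_zero.1 (natDegree_le_iff_coeff_eq_zero.2 fun j hj => ?_))
    rw [← hc, coeff_coactionBaseChange_sum]
    refine Finset.sum_eq_zero fun i _ => ?_
    have hi : (φ (c i)).natDegree = 0 := by
      by_contra h
      exact absurd (hn.le _ h) ((hdeg i).trans_lt hlt).not_ge
    dsimp only
    rw [coeff_eq_zero_of_natDegree_lt (hi.trans_lt hj), TensorProduct.tmul_zero]
  ex := by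
    obtain ⟨x, hx⟩ := hn.ex
    refine ⟨1 ⊗ₜ x, ?_⟩
    have hinj := Algebra.TensorProduct.includeRight_injective (A := K) (B := A)
      (algebraMap k K).injective
    have h : coactionBaseChange K φ (1 ⊗ₜ x) =
        (φ x).map (Algebra.TensorProduct.includeRight : A →ₐ[k] K ⊗[k] A).toRingHom := by
      ext j
      rw [coeff_coactionBaseChange_tmul, coeff_map]
      rfl
    rw [h, natDegree_map_eq_of_injective hinj, hx]

theorem Subalgebra.eq_top_of_baseChange_eq_top {W : Subalgebra k A}
    (h : W.baseChange K = ⊤) : W = ⊤ := by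
  have hs : Function.Surjective (W.val.toLinearMap.lTensor K) := fun b => by
    have hb : b ∈ W.baseChange K := h ▸ Algebra.mem_top
    obtain ⟨c, hc⟩ := hb
    exact ⟨c, hc⟩
  have hs' := (Module.FaithfullyFlat.lTensor_surjective_iff_surjective k K _).1 hs
  exact eq_top_iff.2 fun a _ => by
    obtain ⟨w, rfl⟩ := hs' a
    exact w.2

end BaseChange

namespace IsIterative

variable {φ : A →ₐ[k] A[X]}

theorem adjoin_eq_top_of_isAlgClosed_form {K : Type*} [Field K] [Algebra k K] [IsAlgClosed K]
    (e : K ⊗[k] A ≃ₐ[K] MvPolynomial (Fin 2) K) {n : ℕ} (hφ : IsIterative φ)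
    (hn : IsMinDegree φ n) {x : A} (hx : (φ x).natDegree = n)
    (hc : ∀ a, (φ a).natDegree ≤ n →
      ∃ r ∈ fixedSubalgebra φ, (φ a).coeff n = (φ x).coeff n * r) :
    Algebra.adjoin (fixedSubalgebra φ) {x} = ⊤ := by
  have : IsDomain (K ⊗[k] A) := e.toMulEquiv.isDomain (MvPolynomial (Fin 2) K)
  have : UniqueFactorizationMonoid (K ⊗[k] A) :=
    e.symm.toMulEquiv.uniqueFactorizationMonoid inferInstance
  have hφK := hφ.baseChange K
  have hnK := hn.baseChange K
  obtain ⟨t, ht⟩ := hφK.exists_fixedSubalgebra_eq_adjoin hnK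
    ((Algebra.TensorProduct.lid K (K ⊗[k] A)).trans e) ((MvPolynomial.aeval 0).comp e.toAlgHom)
  have := isPrincipalIdealRing_of_eq_adjoin ht
  obtain ⟨s, hs, hsc⟩ := hφK.exists_dvd_coeff hnK
  have htop := hφK.adjoin_eq_top hnK ht hs hsc
  let W : Subalgebra k A := (Algebra.adjoin (fixedSubalgebra φ) {x}).restrictScalars k
  have hW : ∀ a, (φ a).natDegree ≤ n → a ∈ W := fun a ha =>
    hφ.mem_adjoin_of_natDegree_le hn hx hc ha
  have hWtop : W = ⊤ := by
    refine Subalgebra.eq_top_of_baseChange_eq_top (K := K) (eq_top_iff.2 fun b _ => ?_)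
    have hb : b ∈ Algebra.adjoin (fixedSubalgebra (coactionBaseChange K φ)) {s} :=
      htop ▸ Algebra.mem_top
    induction hb using Algebra.adjoin_induction with
    | mem y hy =>
      rw [Set.mem_singleton_iff.1 hy]
      exact mem_baseChange_of_natDegree_le hW hs.le
    | algebraMap r =>
      exact mem_baseChange_of_natDegree_le hW ((hφK.mem_iff.1 r.2).le.trans n.zero_le)
    | add _ _ _ _ h1 h2 => exact add_mem (h1 Algebra.mem_top) (h2 Algebra.mem_top)
    | mul _ _ _ _ h1 h2 => exact mul_mem (h1 Algebra.mem_top) (h2 Algebra.mem_top)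
  exact eq_top_iff.2 fun a _ => hWtop.ge (Algebra.mem_top : a ∈ ⊤)

theorem nonempty_algEquiv [IsDomain A] [UniqueFactorizationMonoid A] {L : Type*} [Field L]
    [Algebra k L] (hφ : IsIterative φ) (h : ∃ a, φ a ≠ C a)
    (e : L ⊗[k] A ≃ₐ[L] MvPolynomial (Fin 2) L) (ε : A →ₐ[k] k) :
    Nonempty (A ≃ₐ[k] MvPolynomial (Fin 2) k) := by
  obtain ⟨n, hn⟩ := hφ.exists_isMinDegree h
  obtain ⟨t, ht⟩ := hφ.exists_fixedSubalgebra_eq_adjoin hn e ε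
  have := isPrincipalIdealRing_of_eq_adjoin ht
  obtain ⟨x, hx, hc⟩ := hφ.exists_dvd_coeff hn
  let e' : AlgebraicClosure L ⊗[k] A ≃ₐ[AlgebraicClosure L]
      MvPolynomial (Fin 2) (AlgebraicClosure L) :=
    (Algebra.TensorProduct.cancelBaseChange k L (AlgebraicClosure L) (AlgebraicClosure L)
      A).symm.trans ((Algebra.TensorProduct.congr AlgEquiv.refl e).trans
        (MvPolynomial.algebraTensorAlgEquiv L (AlgebraicClosure L)))
  have htop := hφ.adjoin_eq_top_of_isAlgClosed_form e' hn hx hc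
  let f : MvPolynomial (Fin 2) k →ₐ[k] A := MvPolynomial.aeval ![t, x]
  have hft : t ∈ f.range := ⟨MvPolynomial.X 0, by simp [f]⟩
  have hfx : x ∈ f.range := ⟨MvPolynomial.X 1, by simp [f]⟩
  have hsurj : Function.Surjective f := fun b => by
    have hb : b ∈ Algebra.adjoin (fixedSubalgebra φ) {x} := htop ▸ Algebra.mem_top
    suffices b ∈ f.range from this
    induction hb using Algebra.adjoin_induction with
    | mem y hy => exact Set.mem_singleton_iff.1 hy ▸ hfx
    | algebraMap r =>
      exact Algebra.adjoin_le (Set.singleton_subset_iff.2 hft) (ht.le r.2)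
    | add _ _ _ _ h1 h2 => exact add_mem h1 h2
    | mul _ _ _ _ h1 h2 => exact mul_mem h1 h2
  exact ⟨(AlgEquiv.ofBijective f ⟨injective_of_surjective_of_form e f hsurj, hsurj⟩).symm⟩

end IsIterative
end

/-- Theorem B: A non-rigid factorial `𝔸²`-form over `k` having a
`k`-rational point is trivial. -/
theorem factorial_retract_nonrigid_trivial [IsDomain A] [UniqueFactorizationMonoid A]
    (L : Type*) [Field L] [Algebra k L]
    (hform : Nonempty ((TensorProduct k L A) ≃ₐ[L] MvPolynomial (Fin 2) L))
    (hpt : Nonempty (A →ₐ[k] k))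
    (hnr : ∃ φ : ExpMap k A, φ.Nontrivial) :
    Nonempty (A ≃ₐ[k] MvPolynomial (Fin 2) k) := by
  obtain ⟨e⟩ := hform
  obtain ⟨ε⟩ := hpt
  obtain ⟨φ, hφ⟩ := hnr
  exact φ.isIterative.nonempty_algEquiv hφ e ε
end
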